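/- Well-definedness of weakly localized states and t^{1/2} localization: Assume (H1) and assume that (H2)[α,β₀] holds with some β₀ ≥ 3/2 for every α ∈ (1/3,1). If lim_{t→∞} Γ_{F,α}(t) = 0 for some α ∈ (1/3,1) and some smooth characteristic function F of [1,∞), then lim_{t→∞} Γ_{F',α'}(t) = 0 for every α' ∈ (1/3,1) and every smooth characteristic function F' of [1,∞); moreover, there exists C > 0 such that ∫_{ℝ³} |x| |φ(t,x)|² dx ≤ C t^{1/2} for all t ≥ 1. -/

import Mathlib

noncomputable section

open MeasureTheory Filter Topology Real

abbrev R3 : Type := EuclideanSpace ℝ (Fin 3)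

/-- `F` is a smooth characteristic function of `[1, ∞)`:
smooth, nondecreasing, `F = 0` on `(-∞, 1/2]`, `F = 1` on `[1, ∞)`, values in `[0,1]`. -/
def IsSmoothChar (F : ℝ → ℝ) : Prop :=
  ContDiff ℝ (⊤ : ℕ∞) F ∧ Monotone F ∧ (∀ x : ℝ, x ≤ 1 / 2 → F x = 0) ∧
    (∀ x : ℝ, 1 ≤ x → F x = 1) ∧ ∀ x : ℝ, 0 ≤ F x ∧ F x ≤ 1

/-- `g(x) = β(|x|)` with `β` smooth, nondecreasing and convex on `[0,∞)`,
`β r = r` for `r ≥ 2`, and `β` constant on `[0,1]`. -/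
structure GoodG (g : R3 → ℝ) (β : ℝ → ℝ) : Prop where
  smooth_g : ContDiff ℝ (⊤ : ℕ∞) g
  smooth_beta : ContDiff ℝ (⊤ : ℕ∞) β
  mono_beta : MonotoneOn β (Set.Ici 0)
  convex_beta : ConvexOn ℝ (Set.Ici 0) β
  beta_eq_id : ∀ r : ℝ, 2 ≤ r → β r = r
  beta_const : ∀ r ∈ Set.Icc (0 : ℝ) 1, β r = β 0
  g_eq : ∀ x : R3, g x = β ‖x‖

/-- The (pointwise) Laplacian of `ψ : ℝ³ → ℂ`. -/
def laplacian (ψ : R3 → ℂ) (x : R3) : ℂ :=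
  ∑ j : Fin 3,
    fderiv ℝ (fun y => fderiv ℝ ψ y (EuclideanSpace.single j 1)) x (EuclideanSpace.single j 1)

/-- The quadratic form `⟨γ⟩_ψ = Im ∫ conj ψ (∇g · ∇ψ)` of `γ = ½(∇g·p + p·∇g)`. -/
def gammaExp (g : R3 → ℝ) (ψ : R3 → ℂ) : ℝ :=
  (∫ x : R3, (starRingEnd ℂ) (ψ x) * fderiv ℝ ψ x (gradient g x)).im

/-- `Γ_{F,α}(t) = ⟨γ⟩_ψ` with `ψ = F(⟨·⟩/t^α)·φ(t,·)`. -/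
def GammaF (g : R3 → ℝ) (φ : ℝ → R3 → ℂ) (F : ℝ → ℝ) (α t : ℝ) : ℝ :=
  gammaExp g fun x => (F (g x / t ^ α) : ℂ) * φ t x

/-- The standing hypotheses on the solution `φ` of `i∂_tφ + Δφ = 𝒩(|φ|,|x|,t)φ`,
including the global `H¹` bound (H1). -/
structure SolSetting (N : ℝ → ℝ → ℝ → ℝ) (φ : ℝ → R3 → ℂ) : Prop where
  smooth : ContDiffOn ℝ (⊤ : ℕ∞) (fun p : ℝ × R3 => φ p.1 p.2) (Set.Ici 0 ×ˢ Set.univ)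
  radial : ∀ t : ℝ, ∀ x y : R3, ‖x‖ = ‖y‖ → φ t x = φ t y
  eqn : ∀ t : ℝ, 0 ≤ t → ∀ x : R3,
    Complex.I * deriv (fun s => φ s x) t + laplacian (φ t) x
      = (N ‖φ t x‖ ‖x‖ t : ℂ) * φ t x
  l2 : ∀ t : ℝ, 0 ≤ t → Integrable fun x : R3 => ‖φ t x‖ ^ 2
  grad_l2 : ∀ t : ℝ, 0 ≤ t → Integrable fun x : R3 => ‖fderiv ℝ (φ t) x‖ ^ 2
  wt_l2 : ∀ t : ℝ, 0 ≤ t → Integrable fun x : R3 => (1 + ‖x‖) * ‖φ t x‖ ^ 2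
  H1 : ∃ C : ℝ, ∀ t : ℝ, 0 ≤ t →
    (∫ x : R3, ‖φ t x‖ ^ 2) + (∫ x : R3, ‖fderiv ℝ (φ t) x‖ ^ 2) ≤ C

/-- Hypothesis (H2)[α, β₀]: uniform decay of the interaction in the exterior region. -/
def H2 (g : R3 → ℝ) (N : ℝ → ℝ → ℝ → ℝ) (φ : ℝ → R3 → ℂ) (α β₀ : ℝ) : Prop :=
  ∀ F : ℝ → ℝ, IsSmoothChar F → ∃ C > (0 : ℝ), ∀ t : ℝ, 1 ≤ t → ∀ x : R3,
    |F (g x / t ^ α) * N ‖φ t x‖ ‖x‖ t| ≤ C * t ^ (-β₀)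




/-- the open quadrant -/
abbrev QQ : Set (ℝ × ℝ) := Set.Ioi 0 ×ˢ Set.Ioi 0

lemma slice_cont {f : ℝ → ℝ → ℝ} (hf : ContinuousOn (Function.uncurry f) QQ) {t : ℝ} (ht : 0 < t) :
    ContinuousOn (f t) (Set.Ioi 0) := by
  have : ContinuousOn (fun r => Function.uncurry f (t, r)) (Set.Ioi 0) :=
    hf.comp (by fun_prop) (fun r hr => ⟨ht, hr⟩)
  exact this

lemma leibniz {f fT : ℝ → ℝ → ℝ} {p q : ℝ} (hp : 0 < p) (hpq : p ≤ q)
    (hf : ContinuousOn (Function.uncurry f) QQ) (hfT : ContinuousOn (Function.uncurry fT) QQ)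
    (hd : ∀ t > 0, ∀ r > 0, HasDerivAt (fun s => f s r) (fT t r) t) {t : ℝ} (ht : 0 < t) :
    HasDerivAt (fun s => ∫ r in p..q, f s r) (∫ r in p..q, fT t r) t := by
  have hsub : Set.uIcc p q ⊆ Set.Ioi 0 := by
    rw [Set.uIcc_of_le hpq]; exact fun x hx => lt_of_lt_of_le hp hx.1
  have hsub' : Set.uIoc p q ⊆ Set.Ioi 0 := Set.uIoc_subset_uIcc.trans hsub
  have hK : IsCompact (Set.Icc (t / 2) (2 * t) ×ˢ Set.Icc p q) := isCompact_Icc.prod isCompact_Icc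
  have hKs : Set.Icc (t / 2) (2 * t) ×ˢ Set.Icc p q ⊆ QQ := by
    rintro ⟨s, r⟩ ⟨h1, h2⟩
    exact ⟨lt_of_lt_of_le (by positivity) h1.1, lt_of_lt_of_le hp h2.1⟩
  obtain ⟨C, hC⟩ := hK.exists_bound_of_continuousOn (hfT.mono hKs)
  have hnhds : Set.Ioo (t / 2) (2 * t) ∈ 𝓝 t := Ioo_mem_nhds (by linarith) (by linarith)
  refine (intervalIntegral.hasDerivAt_integral_of_dominated_loc_of_deriv_le
    (bound := fun _ => C) hnhds ?_ ?_ ?_ ?_ ?_ ?_).2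
  · filter_upwards [hnhds] with s hs
    exact ((slice_cont hf (lt_trans (by positivity) hs.1)).mono hsub').aestronglyMeasurable
      measurableSet_uIoc
  · exact ((slice_cont hf ht).mono hsub).intervalIntegrable
  · exact ((slice_cont hfT ht).mono hsub').aestronglyMeasurable measurableSet_uIoc
  · refine Eventually.of_forall fun r hr s hs => ?_
    rw [Set.uIoc_of_le hpq] at hr
    exact hC (s, r) ⟨⟨hs.1.le, hs.2.le⟩, ⟨hr.1.le, hr.2⟩⟩
  · exact intervalIntegrable_const
  · refine Eventually.of_forall fun r hr s hs => ?_
    exact hd s (lt_trans (by positivity) hs.1) r (hsub' hr)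

/-- One dimensional (radial) data: `v = a + i b` solves `i v_t + v_rr = n v`. -/
structure Dat where
  a : ℝ → ℝ → ℝ
  b : ℝ → ℝ → ℝ
  aT : ℝ → ℝ → ℝ
  bT : ℝ → ℝ → ℝ
  a1 : ℝ → ℝ → ℝ
  b1 : ℝ → ℝ → ℝ
  a2 : ℝ → ℝ → ℝ
  b2 : ℝ → ℝ → ℝ
  aT1 : ℝ → ℝ → ℝ
  bT1 : ℝ → ℝ → ℝ
  n : ℝ → ℝ → ℝ
  K : ℝ
  c_a : ContinuousOn (Function.uncurry a) QQ
  c_b : ContinuousOn (Function.uncurry b) QQ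
  c_aT : ContinuousOn (Function.uncurry aT) QQ
  c_bT : ContinuousOn (Function.uncurry bT) QQ
  c_a1 : ContinuousOn (Function.uncurry a1) QQ
  c_b1 : ContinuousOn (Function.uncurry b1) QQ
  c_a2 : ContinuousOn (Function.uncurry a2) QQ
  c_b2 : ContinuousOn (Function.uncurry b2) QQ
  c_aT1 : ContinuousOn (Function.uncurry aT1) QQ
  c_bT1 : ContinuousOn (Function.uncurry bT1) QQ
  d_aT : ∀ t > 0, ∀ r > 0, HasDerivAt (fun s => a s r) (aT t r) t
  d_bT : ∀ t > 0, ∀ r > 0, HasDerivAt (fun s => b s r) (bT t r) t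
  d_a1 : ∀ t > 0, ∀ r > 0, HasDerivAt (fun s => a t s) (a1 t r) r
  d_b1 : ∀ t > 0, ∀ r > 0, HasDerivAt (fun s => b t s) (b1 t r) r
  d_a2 : ∀ t > 0, ∀ r > 0, HasDerivAt (fun s => a1 t s) (a2 t r) r
  d_b2 : ∀ t > 0, ∀ r > 0, HasDerivAt (fun s => b1 t s) (b2 t r) r
  d_a1T : ∀ t > 0, ∀ r > 0, HasDerivAt (fun s => a1 s r) (aT1 t r) t
  d_b1T : ∀ t > 0, ∀ r > 0, HasDerivAt (fun s => b1 s r) (bT1 t r) t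
  d_aT1 : ∀ t > 0, ∀ r > 0, HasDerivAt (fun s => aT t s) (aT1 t r) r
  d_bT1 : ∀ t > 0, ∀ r > 0, HasDerivAt (fun s => bT t s) (bT1 t r) r
  pde_a : ∀ t > 0, ∀ r > 0, aT t r = - b2 t r + n t r * b t r
  pde_b : ∀ t > 0, ∀ r > 0, bT t r = a2 t r - n t r * a t r
  int_w : ∀ t ≥ 1, IntegrableOn (fun r => r * (a t r ^ 2 + b t r ^ 2)) (Set.Ioi (1 / 2))
  int_rho : ∀ t ≥ 1, IntegrableOn (fun r => a t r ^ 2 + b t r ^ 2) (Set.Ioi (1 / 2))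
  int_e : ∀ t ≥ 1, IntegrableOn (fun r => a1 t r ^ 2 + b1 t r ^ 2) (Set.Ioi (1 / 2))
  bd : ∀ t ≥ 1, (∫ r in Set.Ioi (1 / 2), (a t r ^ 2 + b t r ^ 2) + (a1 t r ^ 2 + b1 t r ^ 2)) ≤ K

namespace Dat
variable (D : Dat)

/-- density -/
def rho (t r : ℝ) : ℝ := D.a t r ^ 2 + D.b t r ^ 2
/-- energy -/
def en (t r : ℝ) : ℝ := D.a1 t r ^ 2 + D.b1 t r ^ 2
/-- current -/
def J (t r : ℝ) : ℝ := D.a t r * D.b1 t r - D.b t r * D.a1 t r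
/-- time derivative of the current -/
def JT (t r : ℝ) : ℝ := (D.aT t r * D.b1 t r + D.a t r * D.bT1 t r) -
  (D.bT t r * D.a1 t r + D.b t r * D.aT1 t r)
/-- time derivative of the density -/
def rhoT (t r : ℝ) : ℝ := 2 * D.a t r * D.aT t r + 2 * D.b t r * D.bT t r

lemma rho_nonneg (t r : ℝ) : 0 ≤ D.rho t r := by unfold rho; positivity
lemma en_nonneg (t r : ℝ) : 0 ≤ D.en t r := by unfold en; positivity

lemma absJ (t r : ℝ) : |D.J t r| ≤ D.rho t r + D.en t r := by
  unfold J rho en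
  rw [abs_le]
  constructor <;> nlinarith [sq_nonneg (D.a t r + D.b1 t r), sq_nonneg (D.a t r - D.b1 t r),
    sq_nonneg (D.b t r + D.a1 t r), sq_nonneg (D.b t r - D.a1 t r), sq_nonneg (D.a t r),
    sq_nonneg (D.b t r), sq_nonneg (D.a1 t r), sq_nonneg (D.b1 t r)]

lemma c_rho : ContinuousOn (Function.uncurry D.rho) QQ := by
  have := D.c_a; have := D.c_b
  exact (D.c_a.pow 2).add (D.c_b.pow 2)

lemma c_en : ContinuousOn (Function.uncurry D.en) QQ := (D.c_a1.pow 2).add (D.c_b1.pow 2)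

lemma c_J : ContinuousOn (Function.uncurry D.J) QQ :=
  (D.c_a.mul D.c_b1).sub (D.c_b.mul D.c_a1)

lemma c_JT : ContinuousOn (Function.uncurry D.JT) QQ :=
  ((D.c_aT.mul D.c_b1).add (D.c_a.mul D.c_bT1)).sub
    ((D.c_bT.mul D.c_a1).add (D.c_b.mul D.c_aT1))

lemma c_rhoT : ContinuousOn (Function.uncurry D.rhoT) QQ :=
  ((continuousOn_const.mul D.c_a).mul D.c_aT).add ((continuousOn_const.mul D.c_b).mul D.c_bT)

lemma d_J {t r : ℝ} (ht : 0 < t) (hr : 0 < r) :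
    HasDerivAt (fun s => D.J s r) (D.JT t r) t :=
  ((D.d_aT t ht r hr).mul (D.d_b1T t ht r hr)).sub ((D.d_bT t ht r hr).mul (D.d_a1T t ht r hr))

lemma d_rho {t r : ℝ} (ht : 0 < t) (hr : 0 < r) :
    HasDerivAt (fun s => D.rho s r) (D.rhoT t r) t := by
  have := ((D.d_aT t ht r hr).pow 2).add ((D.d_bT t ht r hr).pow 2)
  refine HasDerivAt.congr_deriv this ?_
  simp [rhoT]

lemma int_re {t : ℝ} (ht : 1 ≤ t) :
    IntegrableOn (fun r => D.rho t r + D.en t r) (Set.Ioi (1 / 2)) :=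
  (D.int_rho t ht).add (D.int_e t ht)

lemma aesm {f : ℝ → ℝ} (hf : ContinuousOn f (Set.Ioi 0)) :
    AEStronglyMeasurable f (volume.restrict (Set.Ioi (1 / 2))) :=
  (hf.mono (Set.Ioi_subset_Ioi (by norm_num))).aestronglyMeasurable measurableSet_Ioi

lemma int_J {t : ℝ} (ht : 1 ≤ t) :
    IntegrableOn (fun r => D.J t r) (Set.Ioi (1 / 2)) :=
  (D.int_re ht).mono' (aesm (slice_cont D.c_J (by linarith)))
    (Eventually.of_forall fun r => D.absJ t r)

lemma K_nonneg : 0 ≤ D.K := le_trans (by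
  apply setIntegral_nonneg measurableSet_Ioi; intro r _; positivity) (D.bd 1 le_rfl)

/-- integrals over finite intervals are controlled by K -/
lemma interval_bd {t q : ℝ} (ht : 1 ≤ t) (hq : 1 / 2 ≤ q) :
    ∫ r in (1 / 2)..q, (D.rho t r + D.en t r) ≤ D.K := by
  rw [intervalIntegral.integral_of_le hq]
  refine le_trans (setIntegral_mono_set (D.int_re ht) ?_ ?_) (D.bd t ht)
  · exact Eventually.of_forall fun r => add_nonneg (D.rho_nonneg t r) (D.en_nonneg t r)
  · exact Eventually.of_forall fun r hr => hr.1

lemma integral_ge {t q c : ℝ} (ht : 1 ≤ t) (hq : 1 / 2 ≤ q) (hc : 0 ≤ c) {X : ℝ → ℝ}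
    (hX : ContinuousOn X (Set.Ioi 0))
    (h : ∀ r, 1 / 2 ≤ r → r ≤ q → -(c * (D.rho t r + D.en t r)) ≤ X r) :
    -(c * D.K) ≤ ∫ r in (1 / 2)..q, X r := by
  have hs : Set.uIcc (1 / 2) q ⊆ Set.Ioi 0 := by
    rw [Set.uIcc_of_le hq]; exact fun x hx => lt_of_lt_of_le (by norm_num) hx.1
  have h0 : (0 : ℝ) < t := by linarith
  have i1 : IntervalIntegrable (fun r => D.rho t r + D.en t r) volume (1 / 2) q :=
    (((slice_cont D.c_rho h0).add (slice_cont D.c_en h0)).mono hs).intervalIntegrable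
  have := intervalIntegral.integral_mono_on hq (i1.const_mul c).neg
    ((hX.mono hs).intervalIntegrable) (fun r hr => h r hr.1 hr.2)
  simp only [intervalIntegral.integral_neg, intervalIntegral.integral_const_mul, Pi.neg_apply] at this
  have h2 := mul_le_mul_of_nonneg_left (D.interval_bd ht hq) hc
  linarith

/-- first identity: flux of the density -/
lemma ibp_rho {t p q : ℝ} (ht : 0 < t) (hp : 0 < p) (hpq : p ≤ q) {w w1 : ℝ → ℝ}
    (hw : ∀ r > 0, HasDerivAt w (w1 r) r) (c1 : ContinuousOn w1 (Set.Ioi 0))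
    (hwp : w p = 0) (hwq : w q = 0) :
    ∫ r in p..q, w r * D.rhoT t r = ∫ r in p..q, 2 * w1 r * D.J t r := by
  have hs : Set.uIcc p q ⊆ Set.Ioi 0 := by
    rw [Set.uIcc_of_le hpq]; exact fun x hx => lt_of_lt_of_le hp hx.1
  have cw : ContinuousOn w (Set.Ioi 0) := fun r hr => (hw r hr).continuousAt.continuousWithinAt
  have cA : ContinuousOn (fun r => w r * D.rhoT t r) (Set.Ioi 0) := cw.mul (slice_cont D.c_rhoT ht)
  have cB : ContinuousOn (fun r => 2 * w1 r * D.J t r) (Set.Ioi 0) :=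
    (continuousOn_const.mul c1).mul (slice_cont D.c_J ht)
  have key : ∫ r in p..q, (2 * w1 r * D.J t r - w r * D.rhoT t r) =
      2 * w q * D.J t q - 2 * w p * D.J t p := by
    apply intervalIntegral.integral_eq_sub_of_hasDerivAt (f := fun r => 2 * w r * D.J t r)
    · intro r hr
      have hr := hs hr
      have hJ := ((D.d_a1 t ht r hr).mul (D.d_b2 t ht r hr)).sub
        ((D.d_b1 t ht r hr).mul (D.d_a2 t ht r hr))
      have := ((hw r hr).const_mul 2).mul hJ
      refine HasDerivAt.congr_deriv this ?_
      simp only [Pi.sub_apply, Pi.mul_apply]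
      have e1 := D.pde_a t ht r hr
      have e2 := D.pde_b t ht r hr
      unfold rhoT J
      rw [e1, e2]; ring
    · exact ((cB.sub cA).mono hs).intervalIntegrable
  rw [hwp, hwq, intervalIntegral.integral_sub ((cB.mono hs).intervalIntegrable)
    ((cA.mono hs).intervalIntegrable)] at key
  linarith

/-- the Morawetz integrand -/
def Q (t : ℝ) (h h1 h3 : ℝ → ℝ) (r : ℝ) : ℝ :=
  2 * h1 r * D.en t r - 1 / 2 * h3 r * D.rho t r
    + 2 * h r * D.n t r * (D.a t r * D.a1 t r + D.b t r * D.b1 t r) + h1 r * D.n t r * D.rho t r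

/-- second identity: Morawetz -/
lemma ibp_J {t p q : ℝ} (ht : 0 < t) (hp : 0 < p) (hpq : p ≤ q) {h h1 h2 h3 : ℝ → ℝ}
    (hh : ∀ r > 0, HasDerivAt h (h1 r) r) (hh1 : ∀ r > 0, HasDerivAt h1 (h2 r) r)
    (hh2 : ∀ r > 0, HasDerivAt h2 (h3 r) r)
    (c3 : ContinuousOn h3 (Set.Ioi 0))
    (zp : h p = 0) (zq : h q = 0) (zp1 : h1 p = 0) (zq1 : h1 q = 0) (zp2 : h2 p = 0)
    (zq2 : h2 q = 0) :
    ContinuousOn (D.Q t h h1 h3) (Set.Ioi 0) ∧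
    ∫ r in p..q, h r * D.JT t r = ∫ r in p..q, D.Q t h h1 h3 r := by
  have hs : Set.uIcc p q ⊆ Set.Ioi 0 := by
    rw [Set.uIcc_of_le hpq]; exact fun x hx => lt_of_lt_of_le hp hx.1
  have c0 : ContinuousOn h (Set.Ioi 0) := fun r hr => (hh r hr).continuousAt.continuousWithinAt
  have c1 : ContinuousOn h1 (Set.Ioi 0) := fun r hr => (hh1 r hr).continuousAt.continuousWithinAt
  have c2 : ContinuousOn h2 (Set.Ioi 0) := fun r hr => (hh2 r hr).continuousAt.continuousWithinAt
  have ca := slice_cont D.c_a ht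
  have cb := slice_cont D.c_b ht
  have ca1 := slice_cont D.c_a1 ht
  have cb1 := slice_cont D.c_b1 ht
  have ca2 := slice_cont D.c_a2 ht
  have cb2 := slice_cont D.c_b2 ht
  have caT := slice_cont D.c_aT ht
  have cbT := slice_cont D.c_bT ht
  have caT1 := slice_cont D.c_aT1 ht
  have cbT1 := slice_cont D.c_bT1 ht
  have cA : ContinuousOn (fun r => h r * D.JT t r) (Set.Ioi 0) := c0.mul (slice_cont D.c_JT ht)
  set B' : ℝ → ℝ := fun r =>
    h1 r * (D.a t r * D.bT t r - D.b t r * D.aT t r)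
    + h r * ((D.a1 t r * D.bT t r + D.a t r * D.bT1 t r) -
        (D.b1 t r * D.aT t r + D.b t r * D.aT1 t r))
    - (h1 r * (D.a1 t r ^ 2 + D.b1 t r ^ 2)
        + h r * (2 * D.a1 t r * D.a2 t r + 2 * D.b1 t r * D.b2 t r))
    - (h2 r * (D.a t r * D.a1 t r + D.b t r * D.b1 t r)
        + h1 r * ((D.a1 t r * D.a1 t r + D.a t r * D.a2 t r)
          + (D.b1 t r * D.b1 t r + D.b t r * D.b2 t r)))
    + 1 / 2 * (h3 r * (D.a t r ^ 2 + D.b t r ^ 2)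
        + h2 r * (2 * D.a t r * D.a1 t r + 2 * D.b t r * D.b1 t r)) with hB'
  have cB : ContinuousOn B' (Set.Ioi 0) := by
    rw [hB']; fun_prop
  have hQ : ∀ r ∈ Set.Ioi (0 : ℝ), D.Q t h h1 h3 r = h r * D.JT t r - B' r := by
    intro r hr
    have e1 := D.pde_a t ht r hr
    have e2 := D.pde_b t ht r hr
    simp only [hB', Q, JT, en, rho]
    rw [e1, e2]; ring
  have cQ : ContinuousOn (D.Q t h h1 h3) (Set.Ioi 0) := (cA.sub cB).congr hQ
  refine ⟨cQ, ?_⟩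
  have key : ∫ r in p..q, B' r = 0 := by
    rw [intervalIntegral.integral_eq_sub_of_hasDerivAt
      (f := fun r => h r * (D.a t r * D.bT t r - D.b t r * D.aT t r)
        - h r * (D.a1 t r ^ 2 + D.b1 t r ^ 2)
        - h1 r * (D.a t r * D.a1 t r + D.b t r * D.b1 t r)
        + 1 / 2 * (h2 r * (D.a t r ^ 2 + D.b t r ^ 2)))]
    · simp [zp, zq, zp1, zq1, zp2, zq2]
    · intro r hr
      have hr := hs hr
      have da := D.d_a1 t ht r hr
      have db := D.d_b1 t ht r hr
      have da1 := D.d_a2 t ht r hr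
      have db1 := D.d_b2 t ht r hr
      have daT := D.d_aT1 t ht r hr
      have dbT := D.d_bT1 t ht r hr
      have := ((((hh r hr).mul ((da.mul dbT).sub (db.mul daT))).sub
        ((hh r hr).mul ((da1.pow 2).add (db1.pow 2)))).sub
        ((hh1 r hr).mul ((da.mul da1).add (db.mul db1)))).add
        (((hh2 r hr).mul ((da.pow 2).add (db.pow 2))).const_mul (1 / 2))
      refine HasDerivAt.congr_deriv this ?_
      simp only [Pi.sub_apply, Pi.mul_apply, Pi.add_apply, Pi.pow_apply, hB']
      norm_num
    · exact (cB.mono hs).intervalIntegrable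
  have e : ∫ r in p..q, D.Q t h h1 h3 r = ∫ r in p..q, (h r * D.JT t r - B' r) :=
    intervalIntegral.integral_congr fun r hr => hQ r (hs hr)
  rw [e, intervalIntegral.integral_sub ((cA.mono hs).intervalIntegrable)
    ((cB.mono hs).intervalIntegrable), key, sub_zero]

end Dat


/-- Derivative package of a smooth characteristic function. -/
structure SCD (F : ℝ → ℝ) where
  f1 : ℝ → ℝ
  f2 : ℝ → ℝ
  f3 : ℝ → ℝ
  C : ℝ
  d1 : ∀ x, HasDerivAt F (f1 x) x
  d2 : ∀ x, HasDerivAt f1 (f2 x) x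
  d3 : ∀ x, HasDerivAt f2 (f3 x) x
  c3 : Continuous f3
  C1 : 1 ≤ C
  b1 : ∀ x, |f1 x| ≤ C
  b2 : ∀ x, |f2 x| ≤ C
  b3 : ∀ x, |f3 x| ≤ C
  nn : ∀ x, 0 ≤ f1 x
  z1 : ∀ x, x ≤ 1 / 2 → f1 x = 0
  z2 : ∀ x, x ≤ 1 / 2 → f2 x = 0
  o1 : ∀ x, 1 ≤ x → f1 x = 0
  o2 : ∀ x, 1 ≤ x → f2 x = 0

lemma zero_of_deriv_left {f f' : ℝ → ℝ} {c : ℝ} (hd : ∀ x, HasDerivAt f (f' x) x)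
    (h : ∀ x, x ≤ 1 / 2 → f x = c) : ∀ x, x ≤ 1 / 2 → f' x = 0 := by
  intro x hx
  have h1 : HasDerivWithinAt f (f' x) (Set.Iic (1 / 2)) x := (hd x).hasDerivWithinAt
  have h2 : HasDerivWithinAt f 0 (Set.Iic (1 / 2)) x :=
    (hasDerivWithinAt_const x _ c).congr (fun y hy => h y hy) (h x hx)
  exact (uniqueDiffOn_Iic (1 / 2 : ℝ) x hx).eq_deriv _ h1 h2

lemma zero_of_deriv_right {f f' : ℝ → ℝ} {c : ℝ} (hd : ∀ x, HasDerivAt f (f' x) x)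
    (h : ∀ x, 1 ≤ x → f x = c) : ∀ x, 1 ≤ x → f' x = 0 := by
  intro x hx
  have h1 : HasDerivWithinAt f (f' x) (Set.Ici 1) x := (hd x).hasDerivWithinAt
  have h2 : HasDerivWithinAt f 0 (Set.Ici 1) x :=
    (hasDerivWithinAt_const x _ c).congr (fun y hy => h y hy) (h x hx)
  exact (uniqueDiffOn_Ici (1 : ℝ) x hx).eq_deriv _ h1 h2

lemma bound_of_zero {f : ℝ → ℝ} (hf : Continuous f) (hl : ∀ x, x ≤ 1 / 2 → f x = 0)
    (hr : ∀ x, 1 ≤ x → f x = 0) : ∃ C, 0 ≤ C ∧ ∀ x, |f x| ≤ C := by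
  obtain ⟨C, hC⟩ := (isCompact_Icc (a := (1 / 2 : ℝ)) (b := 1)).exists_bound_of_continuousOn
    hf.continuousOn
  refine ⟨|C|, abs_nonneg _, fun x => ?_⟩
  by_cases h : x ∈ Set.Icc (1 / 2 : ℝ) 1
  · exact (hC x h).trans (le_abs_self _)
  · simp only [Set.mem_Icc, not_and_or, not_le] at h
    rcases h with h | h
    · rw [hl x h.le]; simp
    · rw [hr x h.le]; simp

lemma scd_exists {F : ℝ → ℝ} (hF : IsSmoothChar F) : Nonempty (SCD F) := by
  obtain ⟨hs, hm, hz, ho, hb⟩ := hF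
  have k0 : ∀ x, HasDerivAt F (deriv F x) x := fun x =>
    (hs.differentiable (by simp)).differentiableAt.hasDerivAt
  have hs1 : ContDiff ℝ (⊤ : ℕ∞) (deriv F) := (contDiff_infty_iff_deriv.1 hs).2
  have hs2 : ContDiff ℝ (⊤ : ℕ∞) (deriv (deriv F)) := (contDiff_infty_iff_deriv.1 hs1).2
  have hs3 : ContDiff ℝ (⊤ : ℕ∞) (deriv (deriv (deriv F))) := (contDiff_infty_iff_deriv.1 hs2).2
  have k1 : ∀ x, HasDerivAt (deriv F) (deriv (deriv F) x) x := fun x =>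
    (hs1.differentiable (by simp)).differentiableAt.hasDerivAt
  have k2 : ∀ x, HasDerivAt (deriv (deriv F)) (deriv (deriv (deriv F)) x) x := fun x =>
    (hs2.differentiable (by simp)).differentiableAt.hasDerivAt
  have z1 := zero_of_deriv_left k0 hz
  have z2 := zero_of_deriv_left k1 z1
  have z3 := zero_of_deriv_left k2 z2
  have o1 := zero_of_deriv_right k0 ho
  have o2 := zero_of_deriv_right k1 o1
  have o3 := zero_of_deriv_right k2 o2
  obtain ⟨C1, p1, hC1⟩ := bound_of_zero hs1.continuous z1 o1
  obtain ⟨C2, p2, hC2⟩ := bound_of_zero hs2.continuous z2 o2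
  obtain ⟨C3, p3, hC3⟩ := bound_of_zero hs3.continuous z3 o3
  exact ⟨{
    f1 := _
    f2 := _
    f3 := _
    C := 1 + C1 + C2 + C3
    d1 := k0
    d2 := k1
    d3 := k2
    c3 := hs3.continuous
    C1 := by linarith
    b1 := fun x => (hC1 x).trans (by linarith)
    b2 := fun x => (hC2 x).trans (by linarith)
    b3 := fun x => (hC3 x).trans (by linarith)
    nn := fun x => hm.deriv_nonneg
    z1 := z1
    z2 := z2
    o1 := o1
    o2 := o2 }⟩

lemma IsSmoothChar.sq {F : ℝ → ℝ} (hF : IsSmoothChar F) : IsSmoothChar (fun x => F x ^ 2) := by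
  obtain ⟨hs, hm, hz, ho, hb⟩ := hF
  refine ⟨hs.pow 2, fun x y h => ?_, fun x hx => by simp [hz x hx], fun x hx => by simp [ho x hx],
    fun x => ⟨by positivity, ?_⟩⟩
  · exact pow_le_pow_left₀ (hb x).1 (hm h) 2
  · exact pow_le_one₀ (hb x).1 (hb x).2

lemma SCD.cF {F : ℝ → ℝ} (S : SCD F) : Continuous F :=
  continuous_iff_continuousAt.2 fun x => (S.d1 x).continuousAt
lemma SCD.c1 {F : ℝ → ℝ} (S : SCD F) : Continuous S.f1 :=
  continuous_iff_continuousAt.2 fun x => (S.d2 x).continuousAt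
lemma SCD.c2 {F : ℝ → ℝ} (S : SCD F) : Continuous S.f2 :=
  continuous_iff_continuousAt.2 fun x => (S.d3 x).continuousAt

lemma cut_lim {k : ℕ → ℝ → ℝ} {q : ℕ → ℝ} {X : ℝ → ℝ} (hq : ∀ n, 1 / 2 ≤ q n)
    (hk : ∀ n, ContinuousOn (k n) (Set.Ioi 0)) (hX : ContinuousOn X (Set.Ioi 0))
    (hI : IntegrableOn X (Set.Ioi (1 / 2)))
    (h0 : ∀ n, ∀ r > 0, 0 ≤ k n r) (h1 : ∀ n, ∀ r > 0, k n r ≤ 1)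
    (hz : ∀ n r, q n ≤ r → k n r = 0)
    (hl : ∀ r > 0, Tendsto (fun n => k n r) atTop (𝓝 1)) :
    Tendsto (fun n => ∫ r in (1 / 2)..(q n), k n r * X r) atTop
      (𝓝 (∫ r in Set.Ioi (1 / 2), X r)) := by
  have e : ∀ n, ∫ r in (1 / 2)..(q n), k n r * X r = ∫ r in Set.Ioi (1 / 2), k n r * X r := by
    intro n
    rw [intervalIntegral.integral_of_le (hq n)]
    refine (setIntegral_eq_of_subset_of_forall_sdiff_eq_zero measurableSet_Ioi
      (fun r hr => hr.1) ?_).symm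
    intro r hr
    have : q n ≤ r := by
      by_contra hc
      exact hr.2 ⟨hr.1, (not_le.1 hc).le⟩
    rw [hz n r this, zero_mul]
  simp_rw [e]
  refine tendsto_integral_of_dominated_convergence (fun r => ‖X r‖) ?_ hI.norm ?_ ?_
  · exact fun n => Dat.aesm ((hk n).mul hX)
  · intro n
    refine (ae_restrict_iff' measurableSet_Ioi).2 (Eventually.of_forall fun r hr => ?_)
    have hr0 : (0 : ℝ) < r := lt_trans (by norm_num) hr
    rw [norm_mul, Real.norm_eq_abs, abs_of_nonneg (h0 n r hr0)]
    exact mul_le_of_le_one_left (norm_nonneg _) (h1 n r hr0)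
  · refine (ae_restrict_iff' measurableSet_Ioi).2 (Eventually.of_forall fun r hr => ?_)
    have hr0 : (0 : ℝ) < r := lt_trans (by norm_num) hr
    simpa using (hl r hr0).mul_const (X r)

set_option maxHeartbeats 1000000 in
/-- pointwise Morawetz lower bound -/
lemma pointwise_bound {a b a1 b1 n l m f f1 f2 f3 g1 g2 g3 k F F1 C nu t y al : ℝ}
    (hl : 0 < l) (hl1 : l ≤ 1) (hm : 0 < m) (hm1 : m ≤ 1) (hC : 1 ≤ C) (ht : 1 ≤ t)
    (hal : 0 < al) (hal1 : al < 1)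
    (hF0 : 0 ≤ F) (hF1 : F ≤ 1) (hf : f = F ^ 2) (hf1 : f1 = 2 * F * F1) (hF1C : |F1| ≤ C)
    (h1 : 0 ≤ f1) (h1C : |f1| ≤ C) (h2 : |f2| ≤ C) (h3 : |f3| ≤ C)
    (e1 : |g1| ≤ C) (e2 : |g2| ≤ C) (e3 : |g3| ≤ C) (k0 : 0 ≤ k) (k1 : k ≤ 1)
    (hn : |F * n| ≤ nu) (hy : 0 ≤ y) (hy1 : f1 * y ≤ f1) :
    -((C * (l * t ^ 2)⁻¹ + C / 2 * l ^ 3 + nu * (1 + 3 * C) + m * (3 * C + 3 * C ^ 2)) *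
        ((a ^ 2 + b ^ 2) + (a1 ^ 2 + b1 ^ 2))) ≤
      (f1 * (y * (-al / t)) * k) * (a * b1 - b * a1) +
      (2 * (l * f1 * k - f * m * g1) * (a1 ^ 2 + b1 ^ 2)
        - 1 / 2 * (l ^ 3 * f3 * k - 3 * l ^ 2 * m * f2 * g1 - 3 * l * m ^ 2 * f1 * g2
            - m ^ 3 * f * g3) * (a ^ 2 + b ^ 2)
        + 2 * (f * k) * n * (a * a1 + b * b1)
        + (l * f1 * k - f * m * g1) * n * (a ^ 2 + b ^ 2)) := by
  set R := a ^ 2 + b ^ 2 with hR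
  set E := a1 ^ 2 + b1 ^ 2 with hE
  have hR0 : 0 ≤ R := by positivity
  have hE0 : 0 ≤ E := by positivity
  have hf0 : 0 ≤ f := by rw [hf]; positivity
  have hf1' : f ≤ 1 := by rw [hf]; exact pow_le_one₀ hF0 hF1
  have ht0 : 0 < t := by linarith
  have hC0 : 0 ≤ C := by linarith
  have hnu : 0 ≤ nu := (abs_nonneg _).trans hn
  -- time derivative term
  have A : -(f1 * k * (l * E + (l * t ^ 2)⁻¹ * R)) ≤
      (f1 * (y * (-al / t)) * k) * (a * b1 - b * a1) := by
    have hJ : |a * b1 - b * a1| / t ≤ l * E + (l * t ^ 2)⁻¹ * R := by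
      have hx : ∀ x z : ℝ, |x * z| / t ≤ l * z ^ 2 + (l * t ^ 2)⁻¹ * x ^ 2 := by
        intro x z
        have key : 0 ≤ (l * |z| * t - |x|) ^ 2 := sq_nonneg _
        have hz : |z| ^ 2 = z ^ 2 := sq_abs z
        have hx : |x| ^ 2 = x ^ 2 := sq_abs x
        rw [abs_mul, ← hz, ← hx]
        have : l * |z| ^ 2 + (l * t ^ 2)⁻¹ * |x| ^ 2 - |x| * |z| / t =
          ((l * |z| * t - |x|) ^ 2 + l * |z| * t * |x|) / (l * t ^ 2) := by
          field_simp; ring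
        have : 0 ≤ ((l * |z| * t - |x|) ^ 2 + l * |z| * t * |x|) / (l * t ^ 2) := by positivity
        linarith
      have h4 : |a * b1 - b * a1| ≤ |a * b1| + |b * a1| := abs_sub _ _
      have h5 := hx a b1
      have h6 := hx b a1
      have h7 : |a * b1 - b * a1| / t ≤ (|a * b1| + |b * a1|) / t := by gcongr
      rw [add_div] at h7
      rw [hE, hR]
      linarith
    have h8 : |(f1 * (y * (-al / t)) * k) * (a * b1 - b * a1)| ≤
        f1 * k * (|a * b1 - b * a1| / t) := by
      have e : (f1 * (y * (-al / t)) * k) * (a * b1 - b * a1) =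
        -(al * (f1 * y) * k * ((a * b1 - b * a1) / t)) := by ring
      rw [e, abs_neg, abs_mul, abs_div, abs_of_pos ht0]
      have : 0 ≤ al * (f1 * y) * k := by positivity
      rw [abs_of_nonneg this]
      have : al * (f1 * y) * k ≤ f1 * k := by
        have : al * (f1 * y) ≤ f1 := by
          have : 0 ≤ f1 * y := by positivity
          exact (mul_le_of_le_one_left this hal1.le).trans hy1
        exact mul_le_mul_of_nonneg_right this k0
      gcongr
    have h9 : f1 * k * (|a * b1 - b * a1| / t) ≤ f1 * k * (l * E + (l * t ^ 2)⁻¹ * R) := by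
      gcongr
    have := (abs_le.1 h8).1
    linarith
  have hfC : f1 ≤ C := (le_abs_self _).trans h1C
  have A2 : f1 * k * ((l * t ^ 2)⁻¹ * R) ≤ C * (l * t ^ 2)⁻¹ * R := by
    have h10 : f1 * k ≤ C := (mul_le_of_le_one_right h1 k1).trans hfC
    have h11 : 0 ≤ (l * t ^ 2)⁻¹ * R := by positivity
    have := mul_le_mul_of_nonneg_right h10 h11
    linarith
  have A3 : 0 ≤ f1 * k * (l * E) := by positivity
  -- kinetic cutoff error
  have B : 2 * f * m * g1 * E ≤ 2 * C * m * E := by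
    have h10 : f * g1 ≤ C := by
      calc f * g1 ≤ f * |g1| := mul_le_mul_of_nonneg_left (le_abs_self g1) hf0
        _ ≤ |g1| := mul_le_of_le_one_left (abs_nonneg _) hf1'
        _ ≤ C := e1
    have h11 : 0 ≤ 2 * m * E := by positivity
    have := mul_le_mul_of_nonneg_right h10 h11
    linarith
  -- third derivative
  have P : ∀ x z : ℝ, |x| ≤ C → |z| ≤ C → |x * z| ≤ C ^ 2 := by
    intro x z h h'
    rw [abs_mul, sq]; exact mul_le_mul h h' (abs_nonneg _) hC0
  have C3 : |l ^ 3 * f3 * k - 3 * l ^ 2 * m * f2 * g1 - 3 * l * m ^ 2 * f1 * g2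
            - m ^ 3 * f * g3| ≤ l ^ 3 * C + m * (6 * C ^ 2 + C) := by
    have t1 : |l ^ 3 * f3 * k| ≤ l ^ 3 * C := by
      rw [abs_mul, abs_mul, abs_of_pos (pow_pos hl 3), abs_of_nonneg k0]
      calc l ^ 3 * |f3| * k ≤ l ^ 3 * C * 1 := by gcongr
        _ = _ := by ring
    have t2 : |3 * l ^ 2 * m * f2 * g1| ≤ 3 * m * C ^ 2 := by
      have : 3 * l ^ 2 * m * f2 * g1 = (3 * l ^ 2 * m) * (f2 * g1) := by ring
      rw [this, abs_mul, abs_of_nonneg (by positivity : 0 ≤ 3 * l ^ 2 * m)]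
      have l2 : l ^ 2 ≤ 1 := pow_le_one₀ hl.le hl1
      calc 3 * l ^ 2 * m * |f2 * g1| ≤ 3 * 1 * m * C ^ 2 := by
            gcongr; exact P _ _ h2 e1
        _ = _ := by ring
    have t3 : |3 * l * m ^ 2 * f1 * g2| ≤ 3 * m * C ^ 2 := by
      have : 3 * l * m ^ 2 * f1 * g2 = (3 * l * m ^ 2) * (f1 * g2) := by ring
      rw [this, abs_mul, abs_of_nonneg (by positivity : 0 ≤ 3 * l * m ^ 2)]
      have l2 : m ^ 2 ≤ m := by nlinarith
      calc 3 * l * m ^ 2 * |f1 * g2| ≤ 3 * 1 * m * C ^ 2 := by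
            gcongr; exact P _ _ h1C e2
        _ = _ := by ring
    have t4 : |m ^ 3 * f * g3| ≤ m * C := by
      have l2 : m ^ 3 ≤ m := by
        have : m ^ 2 ≤ 1 := pow_le_one₀ hm.le hm1
        nlinarith
      rw [abs_mul, abs_mul, abs_of_pos (pow_pos hm 3), abs_of_nonneg hf0]
      calc m ^ 3 * f * |g3| ≤ m * 1 * C := by gcongr
        _ = _ := by ring
    have := abs_sub (l ^ 3 * f3 * k - 3 * l ^ 2 * m * f2 * g1 - 3 * l * m ^ 2 * f1 * g2)
      (m ^ 3 * f * g3)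
    have := abs_sub (l ^ 3 * f3 * k - 3 * l ^ 2 * m * f2 * g1) (3 * l * m ^ 2 * f1 * g2)
    have := abs_sub (l ^ 3 * f3 * k) (3 * l ^ 2 * m * f2 * g1)
    linarith
  have C4 := mul_le_mul_of_nonneg_right ((le_abs_self _).trans C3) hR0
  -- nonlinear terms
  have D1 : -(nu * (R + E)) ≤ 2 * (f * k) * n * (a * a1 + b * b1) := by
    have q1 : |f * k * n| ≤ nu := by
      have : f * k * n = (F * k) * (F * n) := by rw [hf]; ring
      rw [this, abs_mul, abs_of_nonneg (by positivity : 0 ≤ F * k)]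
      have : F * k ≤ 1 := mul_le_one₀ hF1 k0 k1
      exact (mul_le_of_le_one_left (abs_nonneg _) this).trans hn
    have q2 : |2 * (a * a1 + b * b1)| ≤ R + E := by
      rw [abs_le, hR, hE]
      constructor <;> nlinarith [sq_nonneg (a + a1), sq_nonneg (a - a1), sq_nonneg (b + b1),
        sq_nonneg (b - b1)]
    have q3 : |2 * (f * k) * n * (a * a1 + b * b1)| ≤ nu * (R + E) := by
      have : 2 * (f * k) * n * (a * a1 + b * b1) = (f * k * n) * (2 * (a * a1 + b * b1)) := by ring
      rw [this, abs_mul]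
      exact mul_le_mul q1 q2 (abs_nonneg _) hnu
    exact (abs_le.1 q3).1
  have D2 : -(nu * (3 * C) * R) ≤ (l * f1 * k - f * m * g1) * n * R := by
    have q1 : |(l * f1 * k - f * m * g1) * n| ≤ nu * (3 * C) := by
      have : (l * f1 * k - f * m * g1) * n = (2 * (l * k) * F1 - F * m * g1) * (F * n) := by
        rw [hf, hf1]; ring
      rw [this, abs_mul, mul_comm nu]
      refine mul_le_mul ?_ hn (abs_nonneg _) (by positivity)
      refine (abs_sub _ _).trans ?_
      have r1 : |2 * (l * k) * F1| ≤ 2 * C := by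
        rw [abs_mul, abs_of_nonneg (by positivity : 0 ≤ 2 * (l * k))]
        have h12 : 2 * (l * k) ≤ 2 := by linarith [mul_le_one₀ hl1 k0 k1]
        exact mul_le_mul h12 hF1C (abs_nonneg _) (by norm_num)
      have r2 : |F * m * g1| ≤ C := by
        rw [abs_mul, abs_of_nonneg (by positivity : 0 ≤ F * m)]
        exact (mul_le_of_le_one_left (abs_nonneg _) (mul_le_one₀ hF1 hm.le hm1)).trans e1
      linarith
    have := mul_le_mul_of_nonneg_right (abs_le.1 q1).1 hR0
    linarith
  have X1 : 0 ≤ C * (l * t ^ 2)⁻¹ * E := by positivity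
  have X2 : 0 ≤ C / 2 * l ^ 3 * E := by positivity
  have X3 : 0 ≤ nu * (3 * C) * E := by positivity
  have X4 : 0 ≤ m * (C + 3 * C ^ 2) * E := by positivity
  have X5 : 0 ≤ m * (5 / 2 * C) * R := by positivity
  linarith [A, A2, A3, B, C4, D1, D2, X1, X2, X3, X4, X5]



lemma c_scale (α : ℝ) : ContinuousOn (fun p : ℝ × ℝ => p.2 * p.1 ^ (-α)) QQ := by
  refine continuousOn_snd.mul (ContinuousOn.rpow_const continuousOn_fst ?_)
  exact fun p hp => Or.inl (ne_of_gt hp.1)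

lemma d_scale (α : ℝ) {t r : ℝ} (ht : 0 < t) :
    HasDerivAt (fun s => r * s ^ (-α)) (r * t ^ (-α) * (-α / t)) t := by
  have := (Real.hasDerivAt_rpow_const (x := t) (p := -α) (Or.inl ht.ne')).const_mul r
  refine this.congr_deriv ?_
  rw [Real.rpow_sub_one ht.ne']; ring

namespace Dat
variable (D : Dat)

/-- one dimensional Γ -/
def Gam (F : ℝ → ℝ) (α t : ℝ) : ℝ := ∫ r in Set.Ioi (1 / 2), F (r * t ^ (-α)) ^ 2 * D.J t r

/-- truncated Γ -/
def GamK (f k : ℝ → ℝ) (α q t : ℝ) : ℝ := ∫ r in (1 / 2)..q, k r * (f (r * t ^ (-α)) * D.J t r)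

lemma gamK_deriv {f : ℝ → ℝ} (S : SCD f) (α : ℝ) {k : ℝ → ℝ} (hk : ContinuousOn k (Set.Ioi 0)) {q t : ℝ}
    (hq : 1 / 2 ≤ q) (ht : 0 < t) :
    HasDerivAt (D.GamK f k α q)
      (∫ r in (1 / 2)..q, k r * (S.f1 (r * t ^ (-α)) * (r * t ^ (-α) * (-α / t)) * D.J t r
        + f (r * t ^ (-α)) * D.JT t r)) t := by
  have ck : ContinuousOn (fun p : ℝ × ℝ => k p.2) QQ :=
    hk.comp continuousOn_snd (fun p hp => hp.2)
  have cf : ContinuousOn (fun p : ℝ × ℝ => f (p.2 * p.1 ^ (-α))) QQ :=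
    S.cF.comp_continuousOn (c_scale α)
  have cf1 : ContinuousOn (fun p : ℝ × ℝ => S.f1 (p.2 * p.1 ^ (-α))) QQ :=
    S.c1.comp_continuousOn (c_scale α)
  have cd : ContinuousOn (fun p : ℝ × ℝ => -α / p.1) QQ :=
    continuousOn_const.div continuousOn_fst (fun p hp => ne_of_gt hp.1)
  refine leibniz (f := fun t r => k r * (f (r * t ^ (-α)) * D.J t r))
    (fT := fun t r => k r * (S.f1 (r * t ^ (-α)) * (r * t ^ (-α) * (-α / t)) * D.J t r
        + f (r * t ^ (-α)) * D.JT t r)) (by norm_num) hq ?_ ?_ ?_ ht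
  · exact ck.mul (cf.mul D.c_J)
  · exact ck.mul (((cf1.mul ((c_scale α).mul cd)).mul D.c_J).add (cf.mul D.c_JT))
  · intro t ht r hr
    exact ((((S.d1 _).comp t (d_scale α ht)).mul (D.d_J ht hr)).const_mul (k r))

/-- the cutoff `1 - F(r m)` -/
def cutk (F : ℝ → ℝ) (m r : ℝ) : ℝ := 1 - F (r * m)

lemma gamK_lower {F : ℝ → ℝ} (hF : IsSmoothChar F) {α δ : ℝ} (hα : 0 < α) (hα1 : α < 1)
    (hd1 : δ ≤ 3 * α - 1) (hd2 : δ ≤ 1 / 2) (hd3 : δ ≤ 1 - α) {T0 Cn : ℝ} (hT : 1 ≤ T0)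
    (hn : ∀ t ≥ T0, ∀ r > 0, |F (r * t ^ (-α)) * D.n t r| ≤ Cn * t ^ (-(3 / 2) : ℝ)) :
    ∃ c1 ≥ 0, ∃ c2 ≥ 0, ∀ R ≥ 1, ∀ t ≥ T0, ∃ d,
      HasDerivAt (D.GamK (fun x => F x ^ 2) (cutk F R⁻¹) α R) d t ∧
      -(c1 * t ^ (-1 - δ) + c2 * R⁻¹) ≤ d := by
  obtain ⟨SF⟩ := scd_exists hF
  set f : ℝ → ℝ := fun x => F x ^ 2 with hf
  have hfs : IsSmoothChar f := hF.sq
  obtain ⟨S⟩ := scd_exists hfs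
  obtain ⟨hs, hm, hz, ho, hb⟩ := hF
  have hK := D.K_nonneg
  have hCn : 0 ≤ Cn := by
    have h1 := (abs_nonneg _).trans (hn T0 le_rfl 1 one_pos)
    have h2 : 0 < T0 ^ (-(3 / 2) : ℝ) := Real.rpow_pos_of_pos (by linarith) _
    exact nonneg_of_mul_nonneg_left h1 h2
  set C := S.C + SF.C with hCdef
  have hC1 : 1 ≤ C := by linarith [S.C1, SF.C1]
  have hSC : S.C ≤ C := by linarith [SF.C1]
  have hFC : SF.C ≤ C := by linarith [S.C1]
  have hC0 : 0 ≤ C := by linarith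
  refine ⟨(C + C / 2 + Cn * (1 + 3 * C)) * D.K, by positivity,
    (3 * C + 3 * C ^ 2) * D.K, by positivity, ?_⟩
  intro R hR t htT
  have ht : 1 ≤ t := hT.trans htT
  have ht0 : 0 < t := by linarith
  have hR0 : 0 < R := by linarith
  set m := R⁻¹ with hmdef
  have hm0 : 0 < m := inv_pos.2 hR0
  have hm1 : m ≤ 1 := inv_le_one_of_one_le₀ hR
  have hq : 1 / 2 ≤ R := by linarith
  have ck : ContinuousOn (cutk F m) (Set.Ioi 0) := by
    unfold cutk
    have := SF.cF
    fun_prop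
  have hder := D.gamK_deriv S α ck hq ht0
  refine ⟨_, hder, ?_⟩
  set l := t ^ (-α) with hl
  have hl0 : 0 < l := Real.rpow_pos_of_pos ht0 _
  have hl1 : l ≤ 1 := Real.rpow_le_one_of_one_le_of_nonpos ht (by linarith)
  -- the weight
  set h : ℝ → ℝ := fun r => f (r * l) * cutk F m r with hh
  set h1 : ℝ → ℝ := fun r => l * S.f1 (r * l) * cutk F m r - f (r * l) * m * SF.f1 (r * m) with hh1
  set h2 : ℝ → ℝ := fun r => l ^ 2 * S.f2 (r * l) * cutk F m r
    - 2 * l * m * S.f1 (r * l) * SF.f1 (r * m) - m ^ 2 * f (r * l) * SF.f2 (r * m) with hh2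
  set h3 : ℝ → ℝ := fun r => l ^ 3 * S.f3 (r * l) * cutk F m r
    - 3 * l ^ 2 * m * S.f2 (r * l) * SF.f1 (r * m) - 3 * l * m ^ 2 * S.f1 (r * l) * SF.f2 (r * m)
    - m ^ 3 * f (r * l) * SF.f3 (r * m) with hh3
  have dl : ∀ (c r : ℝ), HasDerivAt (fun r => r * c) c r := fun c r => by
    simpa using (hasDerivAt_id r).mul_const c
  have df : ∀ r, HasDerivAt (fun r => f (r * l)) (S.f1 (r * l) * l) r := fun r =>
    HasDerivAt.comp (h₂ := f) (h := fun r => r * l) r (S.d1 (r * l)) (dl l r)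
  have df1 : ∀ r, HasDerivAt (fun r => S.f1 (r * l)) (S.f2 (r * l) * l) r := fun r =>
    (S.d2 (r * l)).comp r (dl l r)
  have df2 : ∀ r, HasDerivAt (fun r => S.f2 (r * l)) (S.f3 (r * l) * l) r := fun r =>
    (S.d3 (r * l)).comp r (dl l r)
  have dk : ∀ r, HasDerivAt (cutk F m) (-(SF.f1 (r * m) * m)) r := fun r => by
    exact ((SF.d1 (r * m)).comp r (dl m r)).const_sub 1
  have dk1 : ∀ r, HasDerivAt (fun r => SF.f1 (r * m)) (SF.f2 (r * m) * m) r := fun r =>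
    (SF.d2 (r * m)).comp r (dl m r)
  have dk2 : ∀ r, HasDerivAt (fun r => SF.f2 (r * m)) (SF.f3 (r * m) * m) r := fun r =>
    (SF.d3 (r * m)).comp r (dl m r)
  have D0 : ∀ r > 0, HasDerivAt h (h1 r) r := fun r _ =>
    ((df r).mul (dk r)).congr_deriv (by simp only [hh1]; ring)
  have D1 : ∀ r > 0, HasDerivAt h1 (h2 r) r := fun r _ =>
    ((((df1 r).const_mul l).mul (dk r)).sub (((df r).mul_const m).mul (dk1 r))).congr_deriv
      (by simp only [hh2]; ring)
  have D2 : ∀ r > 0, HasDerivAt h2 (h3 r) r := fun r _ =>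
    (((((df2 r).const_mul (l ^ 2)).mul (dk r)).sub (((df1 r).const_mul (2 * l * m)).mul (dk1 r))).sub
      (((df r).const_mul (m ^ 2)).mul (dk2 r))).congr_deriv
      (by simp only [hh3]; ring)
  have c3 : ContinuousOn h3 (Set.Ioi 0) := by
    have := S.c3; have := S.c2; have := S.c1; have := S.cF
    have := SF.c3; have := SF.c2; have := SF.c1
    rw [hh3]
    fun_prop
  have yp : (1 / 2 : ℝ) * l ≤ 1 / 2 := by linarith
  have f0 : f (1 / 2 * l) = 0 := by simp only [hf]; rw [hz _ yp]; norm_num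
  have zR : R * m = 1 := mul_inv_cancel₀ hR0.ne'
  have kR : cutk F m R = 0 := by simp only [cutk, zR, ho 1 le_rfl, sub_self]
  have F1R : SF.f1 (R * m) = 0 := SF.o1 _ zR.ge
  have F2R : SF.f2 (R * m) = 0 := SF.o2 _ zR.ge
  obtain ⟨cQ, hQ⟩ := D.ibp_J ht0 (by norm_num : (0 : ℝ) < 1 / 2) hq D0 D1 D2 c3
    (by simp only [hh, f0, zero_mul]) (by simp only [hh, kR, mul_zero])
    (by simp only [hh1, f0, S.z1 _ yp]; ring) (by simp only [hh1, kR, F1R]; ring)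
    (by simp only [hh2, f0, S.z1 _ yp, S.z2 _ yp]; ring) (by simp only [hh2, kR, F1R, F2R]; ring)
  set X : ℝ → ℝ := fun r => S.f1 (r * l) * (r * l * (-α / t)) * cutk F m r * D.J t r with hX
  have cX : ContinuousOn X (Set.Ioi 0) := by
    have := S.c1
    have := slice_cont D.c_J ht0
    rw [hX]; fun_prop
  have ss : Set.uIcc (1 / 2) R ⊆ Set.Ioi 0 := by
    rw [Set.uIcc_of_le hq]; exact fun x hx => lt_of_lt_of_le (by norm_num) hx.1
  have ch : ContinuousOn h (Set.Ioi 0) := fun r hr => (D0 r hr).continuousAt.continuousWithinAt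
  have split : (∫ r in (1 / 2)..R, cutk F m r * (S.f1 (r * l) * (r * l * (-α / t)) * D.J t r
        + f (r * l) * D.JT t r)) = ∫ r in (1 / 2)..R, (X r + D.Q t h h1 h3 r) := by
    have i3 : IntervalIntegrable (fun r => h r * D.JT t r) volume (1 / 2) R :=
      ((ch.mul (slice_cont D.c_JT ht0)).mono ss).intervalIntegrable
    rw [intervalIntegral.integral_add ((cX.mono ss).intervalIntegrable)
      ((cQ.mono ss).intervalIntegrable), ← hQ, ← intervalIntegral.integral_add
      ((cX.mono ss).intervalIntegrable)
      i3]
    refine intervalIntegral.integral_congr fun r _ => ?_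
    simp only [hX, hh]; ring
  rw [split]
  set c : ℝ := C * (l * t ^ 2)⁻¹ + C / 2 * l ^ 3 + Cn * t ^ (-(3 / 2) : ℝ) * (1 + 3 * C)
    + m * (3 * C + 3 * C ^ 2) with hc
  have tpos : ∀ x : ℝ, 0 < t ^ x := fun x => Real.rpow_pos_of_pos ht0 x
  have hc0 : 0 ≤ c := by have := tpos (-(3 / 2)); positivity
  have main := D.integral_ge ht hq hc0 (X := fun r => X r + D.Q t h h1 h3 r) (cX.add cQ) (by
    intro r hr hrR
    have hr0 : 0 < r := by linarith
    have hf1 : S.f1 (r * l) = 2 * F (r * l) * SF.f1 (r * l) := by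
      have e1 := S.d1 (r * l)
      have e2 := (SF.d1 (r * l)).pow 2
      have e3 := e1.unique e2
      rw [e3]; simp
    have hy : 0 ≤ r * l := by positivity
    have hy1 : S.f1 (r * l) * (r * l) ≤ S.f1 (r * l) := by
      by_cases hc : r * l ≤ 1
      · exact mul_le_of_le_one_right (S.nn _) hc
      · rw [S.o1 _ (not_le.1 hc).le, zero_mul]
    have := pointwise_bound (a := D.a t r) (b := D.b t r) (a1 := D.a1 t r) (b1 := D.b1 t r)
      (n := D.n t r) (f := f (r * l)) (f3 := S.f3 (r * l)) (f2 := S.f2 (r * l))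
      (g1 := SF.f1 (r * m)) (g2 := SF.f2 (r * m)) (g3 := SF.f3 (r * m))
      (k := cutk F m r) (al := α)
      hl0 hl1 hm0 hm1 hC1 ht hα hα1 (hb (r * l)).1 (hb (r * l)).2 rfl hf1
      ((SF.b1 _).trans hFC) (S.nn _) ((S.b1 _).trans hSC) ((S.b2 _).trans hSC)
      ((S.b3 _).trans hSC) ((SF.b1 _).trans hFC) ((SF.b2 _).trans hFC) ((SF.b3 _).trans hFC)
      (by unfold cutk; linarith [(hb (r * m)).2]) (by unfold cutk; linarith [(hb (r * m)).1])
      (hn t htT r hr0) hy hy1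
    exact this)
  refine le_trans ?_ main
  rw [neg_le_neg_iff]
  have p1 : (l * t ^ 2)⁻¹ ≤ t ^ (-1 - δ) := by
    have : (l * t ^ 2)⁻¹ = t ^ (α - 2) := by
      rw [hl, ← Real.rpow_natCast t 2, ← Real.rpow_add ht0, ← Real.rpow_neg ht0.le]
      congr 1; push_cast; ring
    rw [this]
    exact Real.rpow_le_rpow_of_exponent_le ht (by linarith)
  have p2 : l ^ 3 ≤ t ^ (-1 - δ) := by
    have : l ^ 3 = t ^ (-(3 * α)) := by
      rw [hl, ← Real.rpow_natCast _ 3, ← Real.rpow_mul ht0.le]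
      congr 1; push_cast; ring
    rw [this]
    exact Real.rpow_le_rpow_of_exponent_le ht (by linarith)
  have p3 : t ^ (-(3 / 2) : ℝ) ≤ t ^ (-1 - δ) :=
    Real.rpow_le_rpow_of_exponent_le ht (by linarith)
  have hcc : c ≤ (C + C / 2 + Cn * (1 + 3 * C)) * t ^ (-1 - δ) + m * (3 * C + 3 * C ^ 2) := by
    have q1 := mul_le_mul_of_nonneg_left p1 hC0
    have q2 := mul_le_mul_of_nonneg_left p2 (by positivity : 0 ≤ C / 2)
    have q3 := mul_le_mul_of_nonneg_left p3 (by positivity : 0 ≤ Cn * (1 + 3 * C))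
    rw [hc]; linarith
  calc c * D.K ≤ _ := mul_le_mul_of_nonneg_right hcc hK
    _ = _ := by ring

lemma int_FJ {f : ℝ → ℝ} (hc : Continuous f) (h0 : ∀ x, 0 ≤ f x) (h1 : ∀ x, f x ≤ 1) (l : ℝ)
    {t : ℝ} (ht : 1 ≤ t) : IntegrableOn (fun r => f (r * l) * D.J t r) (Set.Ioi (1 / 2)) := by
  refine (D.int_re ht).mono' (aesm (ContinuousOn.mul ?_ (slice_cont D.c_J (by linarith))))
    (Eventually.of_forall fun r => ?_)
  · exact Continuous.continuousOn (by fun_prop)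
  · rw [norm_mul, Real.norm_eq_abs, abs_of_nonneg (h0 _)]
    exact (mul_le_of_le_one_left (norm_nonneg _) (h1 _)).trans (D.absJ t r)

lemma abs_Gam_le {F : ℝ → ℝ} (hF : IsSmoothChar F) (α : ℝ) {t : ℝ} (ht : 1 ≤ t) :
    |D.Gam F α t| ≤ D.K := by
  have h := norm_integral_le_of_norm_le (f := fun r => F (r * t ^ (-α)) ^ 2 * D.J t r)
    (D.int_re ht) (Eventually.of_forall fun r => ?_)
  · exact h.trans (D.bd t ht)
  obtain ⟨S⟩ := scd_exists hF
  rw [norm_mul, Real.norm_eq_abs, abs_of_nonneg (hF.sq.2.2.2.2 _).1]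
  exact (mul_le_of_le_one_left (norm_nonneg _) (hF.sq.2.2.2.2 _).2).trans (D.absJ t r)

theorem gam_mono {F : ℝ → ℝ} (hF : IsSmoothChar F) {α δ : ℝ} (hα : 0 < α) (hα1 : α < 1)
    (hd0 : 0 < δ)
    (hd1 : δ ≤ 3 * α - 1) (hd2 : δ ≤ 1 / 2) (hd3 : δ ≤ 1 - α) {T0 Cn : ℝ} (hT : 1 ≤ T0)
    (hn : ∀ t ≥ T0, ∀ r > 0, |F (r * t ^ (-α)) * D.n t r| ≤ Cn * t ^ (-(3 / 2) : ℝ)) :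
    ∃ c ≥ 0, MonotoneOn (fun t => D.Gam F α t - c * t ^ (-δ)) (Set.Ici T0) := by
  obtain ⟨c1, hc1, c2, hc2, hmain⟩ := D.gamK_lower hF hα hα1 hd1 hd2 hd3 hT hn
  obtain ⟨SF⟩ := scd_exists hF
  obtain ⟨S⟩ := scd_exists hF.sq
  refine ⟨c1 / δ, by positivity, ?_⟩
  set G : ℕ → ℝ → ℝ := fun n t =>
    D.GamK (fun x => F x ^ 2) (cutk F ((n : ℝ) + 1)⁻¹) α ((n : ℝ) + 1) t with hG
  have hmono : ∀ n : ℕ, MonotoneOn (fun t => G n t - c1 / δ * t ^ (-δ) + c2 * ((n : ℝ) + 1)⁻¹ * t)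
      (Set.Ici T0) := by
    intro n
    have hder : ∀ t ≥ T0, ∃ d, 0 ≤ d ∧
        HasDerivAt (fun t => G n t - c1 / δ * t ^ (-δ) + c2 * ((n : ℝ) + 1)⁻¹ * t) d t := by
      intro t ht
      have ht0 : 0 < t := by linarith [show T0 ≤ t from ht]
      obtain ⟨d, hd, hle⟩ := hmain ((n : ℝ) + 1) (by linarith [(Nat.cast_nonneg n : (0 : ℝ) ≤ n)]) t ht
      have e1 := (Real.hasDerivAt_rpow_const (x := t) (p := -δ) (Or.inl ht0.ne')).const_mul (c1 / δ)
      have e2 := (hasDerivAt_id t).const_mul (c2 * ((n : ℝ) + 1)⁻¹)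
      refine ⟨_, ?_, (hd.sub e1).add e2⟩
      have : c1 / δ * (-δ * t ^ (-δ - 1)) = -(c1 * t ^ (-1 - δ)) := by
        rw [show -δ - 1 = -1 - δ by ring]; field_simp
      rw [this]; linarith
    refine monotoneOn_of_deriv_nonneg (convex_Ici T0) ?_ ?_ ?_
    · intro t ht
      obtain ⟨d, _, hd⟩ := hder t ht
      exact hd.continuousAt.continuousWithinAt
    · intro t ht
      rw [interior_Ici] at ht
      obtain ⟨d, _, hd⟩ := hder t (le_of_lt ht)
      exact hd.differentiableAt.differentiableWithinAt
    · intro t ht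
      rw [interior_Ici] at ht
      obtain ⟨d, h0, hd⟩ := hder t (le_of_lt ht)
      rw [hd.deriv]; exact h0
  have hn0 : Tendsto (fun n : ℕ => ((n : ℝ) + 1)⁻¹) atTop (𝓝 0) := by
    simpa using tendsto_one_div_add_atTop_nhds_zero_nat (𝕜 := ℝ)
  have hlim : ∀ t ≥ T0, Tendsto (fun n : ℕ => G n t - c1 / δ * t ^ (-δ) + c2 * ((n : ℝ) + 1)⁻¹ * t)
      atTop (𝓝 (D.Gam F α t - c1 / δ * t ^ (-δ))) := by
    intro t ht
    have ht1 : 1 ≤ t := hT.trans ht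
    have hG' : Tendsto (fun n => G n t) atTop (𝓝 (D.Gam F α t)) := by
      refine cut_lim (k := fun n => cutk F ((n : ℝ) + 1)⁻¹) (q := fun n => (n : ℝ) + 1) ?_ ?_ ?_ ?_ ?_ ?_ ?_ ?_
      · intro n; linarith [(Nat.cast_nonneg n : (0 : ℝ) ≤ n)]
      · intro n
        have := SF.cF
        unfold cutk; fun_prop
      · have := S.cF
        have := slice_cont D.c_J (by linarith : 0 < t)
        exact (S.cF.comp (continuous_id.mul continuous_const)).continuousOn.mul this
      · exact D.int_FJ S.cF (fun x => (hF.sq.2.2.2.2 x).1) (fun x => (hF.sq.2.2.2.2 x).2) _ ht1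
      · intro n r _; unfold cutk; linarith [(hF.2.2.2.2 (r * ((n : ℝ) + 1)⁻¹)).2]
      · intro n r _; unfold cutk; linarith [(hF.2.2.2.2 (r * ((n : ℝ) + 1)⁻¹)).1]
      · intro n r hr
        have : 1 ≤ r * ((n : ℝ) + 1)⁻¹ := by
          rw [← div_eq_mul_inv, one_le_div (by positivity)]; exact hr
        unfold cutk; rw [hF.2.2.2.1 _ this, sub_self]
      · intro r _
        have h1 : Tendsto (fun n : ℕ => r * ((n : ℝ) + 1)⁻¹) atTop (𝓝 0) := by
          simpa using hn0.const_mul r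
        have h2 := (SF.cF.tendsto 0).comp h1
        rw [hF.2.2.1 0 (by norm_num)] at h2
        simpa [cutk] using h2.const_sub 1
    have := (hG'.sub_const (c1 / δ * t ^ (-δ))).add ((hn0.const_mul c2).mul_const t)
    simpa using this
  intro s hs t ht hst
  exact le_of_tendsto_of_tendsto' (hlim s hs) (hlim t ht) (fun n => hmono n hs ht hst)

end Dat


/-- primitive of `F²` -/
def Gp (F : ℝ → ℝ) (x : ℝ) : ℝ := ∫ y in (0 : ℝ)..x, F y ^ 2


lemma Gp_cont2 {F : ℝ → ℝ} (hF : IsSmoothChar F) : Continuous (fun y => F y ^ 2) := hF.1.continuous.pow 2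

lemma Gp_deriv {F : ℝ → ℝ} (hF : IsSmoothChar F) (x : ℝ) : HasDerivAt (Gp F) (F x ^ 2) x := by
  have c := Gp_cont2 hF
  exact intervalIntegral.integral_hasDerivAt_right (c.intervalIntegrable _ _)
    (c.stronglyMeasurableAtFilter _ _) c.continuousAt

lemma Gp_nonneg {F : ℝ → ℝ} (_hF : IsSmoothChar F) {x : ℝ} (hx : 0 ≤ x) : 0 ≤ Gp F x :=
  intervalIntegral.integral_nonneg hx fun y _ => sq_nonneg _

lemma Gp_le {F : ℝ → ℝ} (hF : IsSmoothChar F) {x : ℝ} (hx : 0 ≤ x) : Gp F x ≤ x * F x ^ 2 := by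
  have c := Gp_cont2 hF
  have : Gp F x ≤ ∫ y in (0 : ℝ)..x, F x ^ 2 := by
    refine intervalIntegral.integral_mono_on hx (c.intervalIntegrable _ _)
      intervalIntegrable_const fun y hy => ?_
    exact hF.sq.2.1 hy.2
  simpa using this

lemma Gp_le' {F : ℝ → ℝ} (hF : IsSmoothChar F) {x : ℝ} (hx : 0 ≤ x) : Gp F x ≤ x :=
  (Gp_le hF hx).trans (mul_le_of_le_one_right hx (hF.sq.2.2.2.2 x).2)

lemma Gp_ge {F : ℝ → ℝ} (hF : IsSmoothChar F) {x : ℝ} (hx : 0 ≤ x) : x - 1 ≤ Gp F x := by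
  have c := Gp_cont2 hF
  by_cases h : x ≤ 1
  · linarith [Gp_nonneg hF hx]
  · push Not at h
    have e : Gp F x = Gp F 1 + ∫ y in (1 : ℝ)..x, F y ^ 2 :=
      (intervalIntegral.integral_add_adjacent_intervals (c.intervalIntegrable _ _)
        (c.intervalIntegrable _ _)).symm
    have e2 : ∫ y in (1 : ℝ)..x, F y ^ 2 = ∫ y in (1 : ℝ)..x, (1 : ℝ) := by
      refine intervalIntegral.integral_congr fun y hy => ?_
      rw [Set.uIcc_of_le h.le] at hy
      simp [hF.2.2.2.1 y hy.1]
    rw [e, e2]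
    have := Gp_nonneg hF (zero_le_one)
    simp; linarith

lemma Gp_sub_ge {F : ℝ → ℝ} (hF : IsSmoothChar F) {x : ℝ} (hx : 0 ≤ x) : -1 ≤ Gp F x - x * F x ^ 2 := by
  by_cases h : x ≤ 1
  · have h1 := Gp_nonneg hF hx
    have h2 : x * F x ^ 2 ≤ 1 := mul_le_one₀ h (sq_nonneg _) (hF.sq.2.2.2.2 x).2
    linarith
  · have h1 := Gp_ge hF hx
    have h2 : x * F x ^ 2 ≤ x := mul_le_of_le_one_right hx (hF.sq.2.2.2.2 x).2
    linarith

lemma Gp_zero {F : ℝ → ℝ} (hF : IsSmoothChar F) {x : ℝ} (hx0 : 0 ≤ x) (hx : x ≤ 1 / 2) : Gp F x = 0 := by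
  have h1 := Gp_nonneg hF hx0
  have h2 := Gp_le hF hx0
  rw [hF.2.2.1 x hx] at h2
  simp at h2; linarith

lemma deriv_mono {f : ℝ → ℝ} {s : ℝ} (h : ∀ t ≥ s, ∃ d, 0 ≤ d ∧ HasDerivAt f d t) :
    MonotoneOn f (Set.Ici s) := by
  refine monotoneOn_of_deriv_nonneg (convex_Ici s) ?_ ?_ ?_
  · intro t ht
    obtain ⟨d, _, hd⟩ := h t ht
    exact hd.continuousAt.continuousWithinAt
  · intro t ht
    rw [interior_Ici] at ht
    obtain ⟨d, _, hd⟩ := h t (le_of_lt ht)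
    exact hd.differentiableAt.differentiableWithinAt
  · intro t ht
    rw [interior_Ici] at ht
    obtain ⟨d, h0, hd⟩ := h t (le_of_lt ht)
    rw [hd.deriv]; exact h0

namespace Dat
variable (D : Dat)

/-- weighted moment -/
def Mom (F : ℝ → ℝ) (α t : ℝ) : ℝ :=
  ∫ r in Set.Ioi (1 / 2), t ^ α * Gp F (r * t ^ (-α)) * D.rho t r

/-- truncated moment -/
def MomK (F k : ℝ → ℝ) (α q t : ℝ) : ℝ :=
  ∫ r in (1 / 2)..q, k r * (t ^ α * Gp F (r * t ^ (-α)) * D.rho t r)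

/-- first moment -/
def W1 (t : ℝ) : ℝ := ∫ r in Set.Ioi (1 / 2), r * D.rho t r

lemma abs_GamK_le {F : ℝ → ℝ} (hF : IsSmoothChar F) (α : ℝ) {k : ℝ → ℝ} {q t : ℝ}
    (hq : 1 / 2 ≤ q) (ht : 1 ≤ t) (h0 : ∀ r > 0, 0 ≤ k r) (h1 : ∀ r > 0, k r ≤ 1) :
    |D.GamK (fun x => F x ^ 2) k α q t| ≤ D.K := by
  have hs : Set.uIcc (1 / 2) q ⊆ Set.Ioi 0 := by
    rw [Set.uIcc_of_le hq]; exact fun x hx => lt_of_lt_of_le (by norm_num) hx.1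
  have ht0 : (0 : ℝ) < t := by linarith
  have i1 : IntervalIntegrable (fun r => D.rho t r + D.en t r) volume (1 / 2) q :=
    (((slice_cont D.c_rho ht0).add (slice_cont D.c_en ht0)).mono hs).intervalIntegrable
  have h := intervalIntegral.norm_integral_le_of_norm_le
    (f := fun r => k r * (F (r * t ^ (-α)) ^ 2 * D.J t r)) hq
    (Eventually.of_forall fun r hr => ?_) i1
  · exact h.trans (D.interval_bd ht hq)
  · have hr0 : 0 < r := lt_trans (by norm_num) hr.1
    rw [norm_mul, norm_mul, Real.norm_eq_abs, Real.norm_eq_abs, abs_of_nonneg (h0 r hr0),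
      abs_of_nonneg (hF.sq.2.2.2.2 _).1]
    refine (mul_le_of_le_one_left (by positivity) (h1 r hr0)).trans ?_
    exact (mul_le_of_le_one_left (norm_nonneg _) (hF.sq.2.2.2.2 _).2).trans (D.absJ t r)

lemma momK_deriv {F : ℝ → ℝ} (hF : IsSmoothChar F) {α : ℝ} (hα : 0 < α) {k k1 : ℝ → ℝ} {c q : ℝ}
    (hq : 1 / 2 ≤ q) (h0 : ∀ r > 0, 0 ≤ k r) (h1 : ∀ r > 0, k r ≤ 1) (hk : ∀ r > 0, HasDerivAt k (k1 r) r)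
    (ck1 : ContinuousOn k1 (Set.Ioi 0)) (hkq : k q = 0) (hc : 0 ≤ c)
    (hb : ∀ r > 0, |k1 r * r| ≤ c) {t : ℝ} (ht : 1 ≤ t) :
    ∃ d, HasDerivAt (D.MomK F k α q) d t ∧
      d ≤ 2 * D.GamK (fun x => F x ^ 2) k α q t + 2 * c * D.K ∧
      2 * D.GamK (fun x => F x ^ 2) k α q t - 2 * c * D.K - D.K * (α * t ^ (α - 1)) ≤ d := by
  have ht0 : 0 < t := by linarith
  have hs : Set.uIcc (1 / 2) q ⊆ Set.Ioi 0 := by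
    rw [Set.uIcc_of_le hq]; exact fun x hx => lt_of_lt_of_le (by norm_num) hx.1
  have cF := Gp_cont2 hF
  have cG : Continuous (Gp F) := continuous_iff_continuousAt.2 fun x => (Gp_deriv hF x).continuousAt
  have ck : ContinuousOn k (Set.Ioi 0) := fun r hr => (hk r hr).continuousAt.continuousWithinAt
  have ckQ : ContinuousOn (fun p : ℝ × ℝ => k p.2) QQ :=
    ck.comp continuousOn_snd (fun p hp => hp.2)
  have cf : ContinuousOn (fun p : ℝ × ℝ => F (p.2 * p.1 ^ (-α)) ^ 2) QQ :=
    cF.comp_continuousOn (c_scale α)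
  have cGQ : ContinuousOn (fun p : ℝ × ℝ => Gp F (p.2 * p.1 ^ (-α))) QQ :=
    cG.comp_continuousOn (c_scale α)
  have cp : ∀ x : ℝ, ContinuousOn (fun p : ℝ × ℝ => p.1 ^ x) QQ := fun x =>
    ContinuousOn.rpow_const continuousOn_fst fun p hp => Or.inl (ne_of_gt hp.1)
  set WT : ℝ → ℝ → ℝ := fun t r =>
    α * t ^ (α - 1) * (Gp F (r * t ^ (-α)) - r * t ^ (-α) * F (r * t ^ (-α)) ^ 2) with hWT
  have cWT : ContinuousOn (Function.uncurry WT) QQ :=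
    (continuousOn_const.mul (cp _)).mul (cGQ.sub ((c_scale α).mul cf))
  have cW : ContinuousOn (fun p : ℝ × ℝ => p.1 ^ α * Gp F (p.2 * p.1 ^ (-α))) QQ :=
    (cp _).mul cGQ
  have hder : HasDerivAt (D.MomK F k α q) (∫ r in (1 / 2)..q, k r * (WT t r * D.rho t r +
      t ^ α * Gp F (r * t ^ (-α)) * D.rhoT t r)) t := by
    refine leibniz (f := fun t r => k r * (t ^ α * Gp F (r * t ^ (-α)) * D.rho t r))
      (fT := fun t r => k r * (WT t r * D.rho t r +
      t ^ α * Gp F (r * t ^ (-α)) * D.rhoT t r)) (by norm_num) hq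
      (ckQ.mul (cW.mul D.c_rho)) (ckQ.mul ((cWT.mul D.c_rho).add (cW.mul D.c_rhoT))) ?_ ht0
    intro t ht r hr
    have e1 := Real.hasDerivAt_rpow_const (x := t) (p := α) (Or.inl ht.ne')
    have e2 := (Gp_deriv hF (r * t ^ (-α))).comp t (d_scale α ht)
    refine (((e1.mul e2).mul (D.d_rho ht hr)).const_mul (k r)).congr_deriv ?_
    simp only [hWT, Function.comp, Pi.mul_apply]
    have e3 : t ^ α = t ^ (α - 1) * t := by
      rw [Real.rpow_sub_one ht.ne']; field_simp
    rw [e3]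
    field_simp
    ring
  refine ⟨_, hder, ?_⟩
  set l := t ^ (-α) with hl
  have hl0 : 0 < l := Real.rpow_pos_of_pos ht0 _
  have hl1 : l ≤ 1 := Real.rpow_le_one_of_one_le_of_nonpos ht (by linarith)
  have hal : t ^ α * l = 1 := by rw [hl, ← Real.rpow_add ht0]; simp
  have htα : 0 < t ^ α := Real.rpow_pos_of_pos ht0 _
  -- spatial derivative of the weight
  set w : ℝ → ℝ := fun r => k r * (t ^ α * Gp F (r * l)) with hw
  set w1 : ℝ → ℝ := fun r => k1 r * (t ^ α * Gp F (r * l)) + k r * F (r * l) ^ 2 with hw1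
  have dw : ∀ r > 0, HasDerivAt w (w1 r) r := by
    intro r hr
    have dl : HasDerivAt (fun r => r * l) l r := by simpa using (hasDerivAt_id r).mul_const l
    have e2 := (Gp_deriv hF (r * l)).comp r dl
    refine ((hk r hr).mul (e2.const_mul (t ^ α))).congr_deriv ?_
    simp only [hw1, Function.comp]
    have : k r * (t ^ α * (F (r * l) ^ 2 * l)) = k r * F (r * l) ^ 2 * (t ^ α * l) := by ring
    rw [this, hal, mul_one]
  have cw : ContinuousOn w (Set.Ioi 0) := fun r hr => (dw r hr).continuousAt.continuousWithinAt
  have c1 : ContinuousOn (fun r => k1 r * (t ^ α * Gp F (r * l))) (Set.Ioi 0) :=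
    ck1.mul (Continuous.continuousOn (by fun_prop))
  have cfl : Continuous (fun r => F (r * l) ^ 2) := cF.comp (continuous_id.mul continuous_const)
  have cw1 : ContinuousOn w1 (Set.Ioi 0) := c1.add (ck.mul cfl.continuousOn)
  have ib := D.ibp_rho ht0 (by norm_num : (0 : ℝ) < 1 / 2) hq dw cw1
    (by simp only [hw]; rw [Gp_zero hF (by positivity) (by linarith)]; simp)
    (by simp only [hw, hkq, zero_mul])
  have cJ := slice_cont D.c_J ht0
  have cA : ContinuousOn (fun r => k r * (WT t r * D.rho t r)) (Set.Ioi 0) :=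
    ck.mul ((slice_cont cWT ht0).mul (slice_cont D.c_rho ht0))
  have cB : ContinuousOn (fun r => k1 r * (t ^ α * Gp F (r * l)) * D.J t r) (Set.Ioi 0) :=
    c1.mul cJ
  have cC : ContinuousOn (fun r => k r * (F (r * l) ^ 2 * D.J t r)) (Set.Ioi 0) :=
    ck.mul (cfl.continuousOn.mul cJ)
  have cE : ContinuousOn (fun r => w r * D.rhoT t r) (Set.Ioi 0) :=
    cw.mul (slice_cont D.c_rhoT ht0)
  have II : ∀ {X : ℝ → ℝ}, ContinuousOn X (Set.Ioi 0) → IntervalIntegrable X volume (1 / 2) q :=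
    fun h => (h.mono hs).intervalIntegrable
  have expr : ∫ r in (1 / 2)..q, k r * (WT t r * D.rho t r +
      t ^ α * Gp F (r * l) * D.rhoT t r) =
      (∫ r in (1 / 2)..q, k r * (WT t r * D.rho t r)) +
      (2 * (∫ r in (1 / 2)..q, k1 r * (t ^ α * Gp F (r * l)) * D.J t r) +
       2 * D.GamK (fun x => F x ^ 2) k α q t) := by
    have e1 : ∫ r in (1 / 2)..q, k r * (WT t r * D.rho t r +
      t ^ α * Gp F (r * l) * D.rhoT t r) = ∫ r in (1 / 2)..q, (k r * (WT t r * D.rho t r) +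
        w r * D.rhoT t r) := by
      refine intervalIntegral.integral_congr fun r _ => ?_
      simp only [hw]; ring
    rw [e1, intervalIntegral.integral_add (II cA) (II cE), ib]
    congr 1
    unfold GamK
    rw [← intervalIntegral.integral_const_mul, ← intervalIntegral.integral_const_mul,
      ← intervalIntegral.integral_add ((II cB).const_mul 2) ((II cC).const_mul 2)]
    refine intervalIntegral.integral_congr fun r _ => ?_
    simp only [hw1]; ring
  rw [expr]
  have tt : 0 < α * t ^ (α - 1) := mul_pos hα (Real.rpow_pos_of_pos ht0 _)
  have WTle : ∀ r > 0, WT t r ≤ 0 := fun r hr => by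
    have := Gp_le hF (by positivity : 0 ≤ r * l)
    exact mul_nonpos_of_nonneg_of_nonpos tt.le (by linarith)
  have WTge : ∀ r > 0, -(α * t ^ (α - 1)) ≤ WT t r := fun r hr => by
    have := Gp_sub_ge hF (by positivity : 0 ≤ r * l)
    have := mul_le_mul_of_nonneg_left this tt.le
    simp only [hWT]; linarith
  have A1 : (∫ r in (1 / 2)..q, k r * (WT t r * D.rho t r)) ≤ 0 := by
    rw [← neg_nonneg, ← intervalIntegral.integral_neg]
    refine intervalIntegral.integral_nonneg hq fun r hr => ?_
    have hr0 : 0 < r := lt_of_lt_of_le (by norm_num) hr.1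
    have := mul_nonneg (h0 r hr0) (mul_nonneg (neg_nonneg.2 (WTle r hr0)) (D.rho_nonneg t r))
    linarith
  have A2 : -(α * t ^ (α - 1) * D.K) ≤ (∫ r in (1 / 2)..q, k r * (WT t r * D.rho t r)) := by
    refine D.integral_ge ht hq tt.le cA fun r hr _ => ?_
    have hr0 : 0 < r := lt_of_lt_of_le (by norm_num) hr
    have hn : 0 ≤ -WT t r * D.rho t r := mul_nonneg (neg_nonneg.2 (WTle r hr0)) (D.rho_nonneg t r)
    have a1 := mul_le_of_le_one_left hn (h1 r hr0)
    have a2 := mul_le_mul_of_nonneg_right (WTge r hr0) (D.rho_nonneg t r)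
    have a3 := mul_nonneg tt.le (D.en_nonneg t r)
    linarith
  have ptB : ∀ r, 1 / 2 ≤ r → |k1 r * (t ^ α * Gp F (r * l)) * D.J t r| ≤
      c * (D.rho t r + D.en t r) := by
    intro r hr
    have hr0 : 0 < r := lt_of_lt_of_le (by norm_num) hr
    have g0 := Gp_nonneg hF (by positivity : 0 ≤ r * l)
    have g1 : t ^ α * Gp F (r * l) ≤ r := by
      have := mul_le_mul_of_nonneg_left (Gp_le' hF (by positivity : 0 ≤ r * l)) htα.le
      calc _ ≤ t ^ α * (r * l) := this
        _ = r * (t ^ α * l) := by ring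
        _ = r := by rw [hal, mul_one]
    rw [abs_mul]
    refine mul_le_mul ?_ (D.absJ t r) (abs_nonneg _) hc
    refine le_trans ?_ (hb r hr0)
    rw [abs_mul (k1 r), abs_mul (k1 r), abs_of_nonneg (by positivity : 0 ≤ t ^ α * Gp F (r * l)), abs_of_pos hr0]
    gcongr
  have B1 := D.integral_ge ht hq hc cB fun r hr _ => (abs_le.1 (ptB r hr)).1
  have B2 := D.integral_ge ht hq hc cB.neg fun r hr _ => neg_le_neg (abs_le.1 (ptB r hr)).2
  simp only [Pi.neg_apply, intervalIntegral.integral_neg] at B2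
  constructor <;> linarith

/-- logarithmic cutoff -/
def lk (F : ℝ → ℝ) (n : ℕ) (r : ℝ) : ℝ := 1 - F (Real.log r * ((n : ℝ) + 1)⁻¹)

lemma lk_zero {F : ℝ → ℝ} (hF : IsSmoothChar F) (n : ℕ) {r : ℝ} (hr : Real.exp ((n : ℝ) + 1) ≤ r) :
    lk F n r = 0 := by
  have hr0 : 0 < r := (Real.exp_pos _).trans_le hr
  have : (n : ℝ) + 1 ≤ Real.log r := (Real.le_log_iff_exp_le hr0).2 hr
  have : 1 ≤ Real.log r * ((n : ℝ) + 1)⁻¹ := by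
    rw [← div_eq_mul_inv, one_le_div (by positivity)]; exact this
  unfold lk; rw [hF.2.2.2.1 _ this, sub_self]

lemma lk_deriv {F : ℝ → ℝ} (S : SCD F) (n : ℕ) {r : ℝ} (hr : 0 < r) :
    HasDerivAt (lk F n) (-(S.f1 (Real.log r * ((n : ℝ) + 1)⁻¹) * (r⁻¹ * ((n : ℝ) + 1)⁻¹))) r :=
  ((S.d1 _).comp r ((Real.hasDerivAt_log hr.ne').mul_const _)).const_sub 1

lemma lk_lim {F : ℝ → ℝ} (hF : IsSmoothChar F) (r : ℝ) :
    Tendsto (fun n => lk F n r) atTop (𝓝 1) := by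
  have hn0 : Tendsto (fun n : ℕ => ((n : ℝ) + 1)⁻¹) atTop (𝓝 0) := by
    simpa using tendsto_one_div_add_atTop_nhds_zero_nat (𝕜 := ℝ)
  have h1 : Tendsto (fun n : ℕ => Real.log r * ((n : ℝ) + 1)⁻¹) atTop (𝓝 0) := by
    simpa using hn0.const_mul (Real.log r)
  have h2 := (hF.1.continuous.tendsto 0).comp h1
  rw [hF.2.2.1 0 (by norm_num)] at h2
  simpa [lk] using h2.const_sub 1

lemma qn_ge (n : ℕ) : (1 / 2 : ℝ) ≤ Real.exp ((n : ℝ) + 1) := by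
  have := Real.add_one_le_exp ((n : ℝ) + 1)
  have : (0 : ℝ) ≤ n := Nat.cast_nonneg n
  linarith

lemma gamK_lim {F : ℝ → ℝ} (hF : IsSmoothChar F) (α : ℝ) {t : ℝ} (ht : 1 ≤ t) :
    Tendsto (fun n : ℕ => D.GamK (fun x => F x ^ 2) (lk F n) α (Real.exp ((n : ℝ) + 1)) t) atTop
      (𝓝 (D.Gam F α t)) := by
  obtain ⟨S⟩ := scd_exists hF
  have cF := Gp_cont2 hF
  refine cut_lim (k := lk F) (q := fun n => Real.exp ((n : ℝ) + 1)) qn_ge ?_ ?_ ?_ ?_ ?_ ?_ ?_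
  · exact fun n r hr => (lk_deriv S n hr).continuousAt.continuousWithinAt
  · exact (cF.comp (continuous_id.mul continuous_const)).continuousOn.mul
      (slice_cont D.c_J (by linarith : 0 < t))
  · exact D.int_FJ cF (fun x => (hF.sq.2.2.2.2 x).1) (fun x => (hF.sq.2.2.2.2 x).2) _ ht
  · intro n r _; unfold lk; linarith [(hF.2.2.2.2 (Real.log r * ((n : ℝ) + 1)⁻¹)).2]
  · intro n r _; unfold lk; linarith [(hF.2.2.2.2 (Real.log r * ((n : ℝ) + 1)⁻¹)).1]
  · exact fun n r hr => lk_zero hF n hr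
  · exact fun r _ => lk_lim hF r

lemma weight_bounds {F : ℝ → ℝ} (hF : IsSmoothChar F) (α : ℝ) {t r : ℝ} (ht : 0 < t) (hr : 0 < r) :
    0 ≤ t ^ α * Gp F (r * t ^ (-α)) ∧ t ^ α * Gp F (r * t ^ (-α)) ≤ r ∧
    r - t ^ α ≤ t ^ α * Gp F (r * t ^ (-α)) := by
  have hl0 : 0 < t ^ (-α) := Real.rpow_pos_of_pos ht _
  have hal : t ^ α * t ^ (-α) = 1 := by rw [← Real.rpow_add ht]; simp
  have htα : 0 < t ^ α := Real.rpow_pos_of_pos ht _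
  have y0 : 0 ≤ r * t ^ (-α) := by positivity
  have e : t ^ α * (r * t ^ (-α)) = r := by
    calc _ = r * (t ^ α * t ^ (-α)) := by ring
      _ = r := by rw [hal, mul_one]
  refine ⟨mul_nonneg htα.le (Gp_nonneg hF y0), ?_, ?_⟩
  · have := mul_le_mul_of_nonneg_left (Gp_le' hF y0) htα.le
    linarith
  · have := mul_le_mul_of_nonneg_left (Gp_ge hF y0) htα.le
    linarith

lemma int_W1 {t : ℝ} (ht : 1 ≤ t) : IntegrableOn (fun r => r * D.rho t r) (Set.Ioi (1 / 2)) :=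
  D.int_w t ht

lemma c_Wrho {F : ℝ → ℝ} (hF : IsSmoothChar F) (α : ℝ) {t : ℝ} (ht : 0 < t) :
    ContinuousOn (fun r => t ^ α * Gp F (r * t ^ (-α)) * D.rho t r) (Set.Ioi 0) := by
  have cG : Continuous (Gp F) := continuous_iff_continuousAt.2 fun x => (Gp_deriv hF x).continuousAt
  exact (Continuous.continuousOn (by fun_prop)).mul (slice_cont D.c_rho ht)

lemma int_Mom {F : ℝ → ℝ} (hF : IsSmoothChar F) (α : ℝ) {t : ℝ} (ht : 1 ≤ t) :
    IntegrableOn (fun r => t ^ α * Gp F (r * t ^ (-α)) * D.rho t r) (Set.Ioi (1 / 2)) := by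
  have ht0 : 0 < t := by linarith
  refine (D.int_W1 ht).mono' (aesm (D.c_Wrho hF α ht0))
    ((ae_restrict_iff' measurableSet_Ioi).2 (Eventually.of_forall fun r hr => ?_))
  have hr0 : (0 : ℝ) < r := lt_trans (by norm_num) hr
  obtain ⟨g0, g1, _⟩ := weight_bounds hF α ht0 hr0
  rw [norm_mul, Real.norm_eq_abs, Real.norm_eq_abs, abs_of_nonneg g0, abs_of_nonneg (D.rho_nonneg t r)]
  exact mul_le_mul_of_nonneg_right g1 (D.rho_nonneg t r)

lemma rho_bd {t : ℝ} (ht : 1 ≤ t) : ∫ r in Set.Ioi (1 / 2), D.rho t r ≤ D.K := by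
  refine le_trans (setIntegral_mono_on (D.int_rho t ht) (D.int_re ht) measurableSet_Ioi
    fun r _ => ?_) (D.bd t ht)
  have := D.en_nonneg t r
  exact le_add_of_nonneg_right this

lemma mom_compare {F : ℝ → ℝ} (hF : IsSmoothChar F) (α : ℝ) {t : ℝ} (ht : 1 ≤ t) :
    D.Mom F α t ≤ D.W1 t ∧ D.W1 t - t ^ α * D.K ≤ D.Mom F α t := by
  have ht0 : 0 < t := by linarith
  have htα : 0 < t ^ α := Real.rpow_pos_of_pos ht0 _
  constructor
  · refine setIntegral_mono_on (D.int_Mom hF α ht) (D.int_W1 ht) measurableSet_Ioi fun r hr => ?_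
    have hr0 : (0 : ℝ) < r := lt_trans (by norm_num) hr
    exact mul_le_mul_of_nonneg_right (weight_bounds hF α ht0 hr0).2.1 (D.rho_nonneg t r)
  · have h : ∫ r in Set.Ioi (1 / 2), (r * D.rho t r - t ^ α * D.rho t r) ≤ D.Mom F α t := by
      refine setIntegral_mono_on ((D.int_W1 ht).sub ((D.int_rho t ht).const_mul _))
        (D.int_Mom hF α ht) measurableSet_Ioi fun r hr => ?_
      have hr0 : (0 : ℝ) < r := lt_trans (by norm_num) hr
      have := mul_le_mul_of_nonneg_right (weight_bounds hF α ht0 hr0).2.2 (D.rho_nonneg t r)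
      linarith
    have ir : IntegrableOn (fun r => t ^ α * D.rho t r) (Set.Ioi (1 / 2)) :=
      (D.int_rho t ht).const_mul _
    rw [integral_sub (D.int_W1 ht) ir, integral_const_mul] at h
    have := mul_le_mul_of_nonneg_left (D.rho_bd ht) htα.le
    unfold W1; linarith

lemma momK_lim {F : ℝ → ℝ} (hF : IsSmoothChar F) (α : ℝ) {t : ℝ} (ht : 1 ≤ t) :
    Tendsto (fun n : ℕ => D.MomK F (lk F n) α (Real.exp ((n : ℝ) + 1)) t) atTop
      (𝓝 (D.Mom F α t)) := by
  obtain ⟨S⟩ := scd_exists hF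
  refine cut_lim (k := lk F) (q := fun n => Real.exp ((n : ℝ) + 1)) qn_ge ?_ ?_ ?_ ?_ ?_ ?_ ?_
  · exact fun n r hr => (lk_deriv S n hr).continuousAt.continuousWithinAt
  · exact D.c_Wrho hF α (by linarith)
  · exact D.int_Mom hF α ht
  · intro n r _; unfold lk; linarith [(hF.2.2.2.2 (Real.log r * ((n : ℝ) + 1)⁻¹)).2]
  · intro n r _; unfold lk; linarith [(hF.2.2.2.2 (Real.log r * ((n : ℝ) + 1)⁻¹)).1]
  · exact fun n r hr => lk_zero hF n hr
  · exact fun r _ => lk_lim hF r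

end Dat


namespace Dat
variable (D : Dat)

lemma lk_cont {F : ℝ → ℝ} (S : SCD F) (n : ℕ) : ContinuousOn (lk F n) (Set.Ioi 0) :=
  fun _ hr => (lk_deriv S n hr).continuousAt.continuousWithinAt

lemma lk_nonneg {F : ℝ → ℝ} (hF : IsSmoothChar F) (n : ℕ) (r : ℝ) : 0 ≤ lk F n r := by
  unfold lk; linarith [(hF.2.2.2.2 (Real.log r * ((n : ℝ) + 1)⁻¹)).2]

lemma lk_le {F : ℝ → ℝ} (hF : IsSmoothChar F) (n : ℕ) (r : ℝ) : lk F n r ≤ 1 := by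
  unfold lk; linarith [(hF.2.2.2.2 (Real.log r * ((n : ℝ) + 1)⁻¹)).1]

lemma gam_ii {F : ℝ → ℝ} (hF : IsSmoothChar F) (α : ℝ) {s t : ℝ} (hs : 1 ≤ s) (hst : s ≤ t) :
    IntervalIntegrable (D.Gam F α) volume s t ∧
    Tendsto (fun n : ℕ => ∫ τ in s..t,
      D.GamK (fun x => F x ^ 2) (lk F n) α (Real.exp ((n : ℝ) + 1)) τ) atTop
      (𝓝 (∫ τ in s..t, D.Gam F α τ)) := by
  obtain ⟨S⟩ := scd_exists hF
  obtain ⟨S2⟩ := scd_exists hF.sq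
  have cG : ∀ n : ℕ, ContinuousOn
      (D.GamK (fun x => F x ^ 2) (lk F n) α (Real.exp ((n : ℝ) + 1))) (Set.Ioi 0) :=
    fun n τ hτ => (D.gamK_deriv S2 α (lk_cont S n) (qn_ge n) hτ).continuousAt.continuousWithinAt
  have hsub : Set.uIoc s t ⊆ Set.Ioi 0 := by
    rw [Set.uIoc_of_le hst]; intro x hx; exact lt_trans (by linarith : (0 : ℝ) < s) hx.1
  have hm : ∀ n : ℕ, AEStronglyMeasurable
      (D.GamK (fun x => F x ^ 2) (lk F n) α (Real.exp ((n : ℝ) + 1)))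
      (volume.restrict (Set.uIoc s t)) := fun n =>
    ((cG n).mono hsub).aestronglyMeasurable measurableSet_uIoc
  have hlim : ∀ τ ∈ Set.uIoc s t, Tendsto (fun n : ℕ =>
      D.GamK (fun x => F x ^ 2) (lk F n) α (Real.exp ((n : ℝ) + 1)) τ) atTop
      (𝓝 (D.Gam F α τ)) := by
    intro τ hτ
    rw [Set.uIoc_of_le hst] at hτ
    exact D.gamK_lim hF α (by linarith [hτ.1])
  have hGm : AEStronglyMeasurable (D.Gam F α) (volume.restrict (Set.uIoc s t)) :=
    aestronglyMeasurable_of_tendsto_ae atTop hm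
      ((ae_restrict_iff' measurableSet_uIoc).2 (Eventually.of_forall hlim))
  have hb : ∀ τ ∈ Set.uIoc s t, ‖D.Gam F α τ‖ ≤ D.K := by
    intro τ hτ
    rw [Set.uIoc_of_le hst] at hτ
    exact D.abs_Gam_le hF α (by linarith [hτ.1])
  constructor
  · refine (intervalIntegrable_const (c := D.K)).mono_fun' hGm
      ((ae_restrict_iff' measurableSet_uIoc).2 (Eventually.of_forall hb))
  · refine intervalIntegral.tendsto_integral_filter_of_dominated_convergence (fun _ => D.K)
      (Eventually.of_forall hm) (Eventually.of_forall fun n => Eventually.of_forall fun τ hτ => ?_)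
      intervalIntegrable_const (Eventually.of_forall hlim)
    rw [Set.uIoc_of_le hst] at hτ
    exact D.abs_GamK_le hF α (qn_ge n) (by linarith [hτ.1]) (fun r _ => lk_nonneg hF n r)
      (fun r _ => lk_le hF n r)

lemma mom_bounds {F : ℝ → ℝ} (hF : IsSmoothChar F) {α : ℝ} (hα : 0 < α) {s t : ℝ} (hs : 1 ≤ s)
    (hst : s ≤ t) :
    D.Mom F α t - D.Mom F α s ≤ 2 * ∫ τ in s..t, D.Gam F α τ ∧
    (2 * ∫ τ in s..t, D.Gam F α τ) - D.K * (t ^ α - s ^ α) ≤ D.Mom F α t - D.Mom F α s := by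
  obtain ⟨S⟩ := scd_exists hF
  obtain ⟨S2⟩ := scd_exists hF.sq
  have key : ∀ n : ℕ,
      D.MomK F (lk F n) α (Real.exp ((n : ℝ) + 1)) t - D.MomK F (lk F n) α (Real.exp ((n : ℝ) + 1)) s
        ≤ (2 * ∫ τ in s..t, D.GamK (fun x => F x ^ 2) (lk F n) α (Real.exp ((n : ℝ) + 1)) τ)
          + 2 * (S.C * ((n : ℝ) + 1)⁻¹) * D.K * (t - s) ∧
      (2 * ∫ τ in s..t, D.GamK (fun x => F x ^ 2) (lk F n) α (Real.exp ((n : ℝ) + 1)) τ)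
          - 2 * (S.C * ((n : ℝ) + 1)⁻¹) * D.K * (t - s) - D.K * (t ^ α - s ^ α) ≤
      D.MomK F (lk F n) α (Real.exp ((n : ℝ) + 1)) t -
        D.MomK F (lk F n) α (Real.exp ((n : ℝ) + 1)) s := by
    intro n
    set q := Real.exp ((n : ℝ) + 1) with hq
    set c := S.C * ((n : ℝ) + 1)⁻¹ with hc
    have hn0 : (0 : ℝ) < ((n : ℝ) + 1)⁻¹ := by positivity
    have hc0 : 0 ≤ c := mul_nonneg (by linarith [S.C1]) hn0.le
    set G := D.GamK (fun x => F x ^ 2) (lk F n) α q with hG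
    have cG : ContinuousOn G (Set.Ioi 0) := fun τ hτ =>
      (D.gamK_deriv S2 α (lk_cont S n) (qn_ge n) hτ).continuousAt.continuousWithinAt
    have dP : ∀ τ ≥ s, HasDerivAt (fun x => ∫ y in s..x, G y) (G τ) τ := by
      intro τ hτ
      have h0 : τ ∈ Set.Ioi (0 : ℝ) := by
        have : (0 : ℝ) < τ := by linarith
        exact this
      refine intervalIntegral.integral_hasDerivAt_right ?_ ?_ (cG.continuousAt (Ioi_mem_nhds h0))
      · refine (cG.mono ?_).intervalIntegrable
        rw [Set.uIcc_of_le hτ]; intro y hy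
        exact lt_of_lt_of_le (by linarith : (0 : ℝ) < s) hy.1
      · exact cG.stronglyMeasurableAtFilter isOpen_Ioi τ h0
    have hM : ∀ τ ≥ s, ∃ d, HasDerivAt (D.MomK F (lk F n) α q) d τ ∧
        d ≤ 2 * G τ + 2 * c * D.K ∧ 2 * G τ - 2 * c * D.K - D.K * (α * τ ^ (α - 1)) ≤ d := by
      intro τ hτ
      refine D.momK_deriv hF hα (qn_ge n) (fun r _ => lk_nonneg hF n r)
        (fun r _ => lk_le hF n r) (fun r hr => lk_deriv S n hr) ?_ (lk_zero hF n le_rfl) hc0 ?_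
        (by linarith)
      · have cl : ContinuousOn (fun r : ℝ => Real.log r * ((n : ℝ) + 1)⁻¹) (Set.Ioi 0) :=
          (Real.continuousOn_log.mono fun r hr => ne_of_gt hr).mul continuousOn_const
        have ci : ContinuousOn (fun r : ℝ => r⁻¹ * ((n : ℝ) + 1)⁻¹) (Set.Ioi 0) :=
          (continuousOn_inv₀.mono fun r hr => ne_of_gt hr).mul continuousOn_const
        exact ((S.c1.comp_continuousOn cl).mul ci).neg
      · intro r hr
        have e : -(S.f1 (Real.log r * ((n : ℝ) + 1)⁻¹) * (r⁻¹ * ((n : ℝ) + 1)⁻¹)) * r =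
            -(S.f1 (Real.log r * ((n : ℝ) + 1)⁻¹) * ((n : ℝ) + 1)⁻¹) := by field_simp
        rw [e, abs_neg, abs_mul, abs_of_pos hn0]
        exact mul_le_mul_of_nonneg_right (S.b1 _) hn0.le
    have m1 : MonotoneOn (fun τ => 2 * (∫ y in s..τ, G y) + 2 * c * D.K * τ -
        D.MomK F (lk F n) α q τ) (Set.Ici s) := by
      refine deriv_mono fun τ hτ => ?_
      obtain ⟨d, hd, h1, _⟩ := hM τ hτ
      refine ⟨_, ?_, (((dP τ hτ).const_mul 2).add ((hasDerivAt_id τ).const_mul (2 * c * D.K))).sub hd⟩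
      linarith
    have m2 : MonotoneOn (fun τ => D.MomK F (lk F n) α q τ - 2 * (∫ y in s..τ, G y) +
        2 * c * D.K * τ + D.K * τ ^ α) (Set.Ici s) := by
      refine deriv_mono fun τ hτ => ?_
      obtain ⟨d, hd, _, h1⟩ := hM τ hτ
      have hτ0 : τ ≠ 0 := by
        have : (0 : ℝ) < τ := by linarith
        exact this.ne'
      refine ⟨_, ?_, ((hd.sub ((dP τ hτ).const_mul 2)).add
        ((hasDerivAt_id τ).const_mul (2 * c * D.K))).add
        ((Real.hasDerivAt_rpow_const (p := α) (Or.inl hτ0)).const_mul D.K)⟩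
      linarith
    have a1 := m1 Set.self_mem_Ici (Set.mem_Ici.2 hst) hst
    have a2 := m2 Set.self_mem_Ici (Set.mem_Ici.2 hst) hst
    simp only [intervalIntegral.integral_same] at a1 a2
    constructor <;> linarith
  have hn0 : Tendsto (fun n : ℕ => ((n : ℝ) + 1)⁻¹) atTop (𝓝 0) := by
    simpa using tendsto_one_div_add_atTop_nhds_zero_nat (𝕜 := ℝ)
  have lc : Tendsto (fun n : ℕ => 2 * (S.C * ((n : ℝ) + 1)⁻¹) * D.K * (t - s)) atTop (𝓝 0) := by
    have := (((hn0.const_mul S.C).const_mul 2).mul_const D.K).mul_const (t - s)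
    simpa using this
  have lM := (D.momK_lim hF α (hs.trans hst)).sub (D.momK_lim hF α hs)
  have lG := ((D.gam_ii hF α hs hst).2).const_mul 2
  constructor
  · have := le_of_tendsto_of_tendsto' lM (lG.add lc) fun n => (key n).1
    simpa using this
  · have := le_of_tendsto_of_tendsto' ((lG.sub lc).sub_const (D.K * (t ^ α - s ^ α))) lM
      fun n => (key n).2
    simpa using this

lemma gam_limit {F : ℝ → ℝ} (hF : IsSmoothChar F) {α δ c T0 : ℝ} (hT : 1 ≤ T0) (hδ : 0 < δ)
    (hm : MonotoneOn (fun t => D.Gam F α t - c * t ^ (-δ)) (Set.Ici T0)) :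
    ∃ L, Tendsto (D.Gam F α) atTop (𝓝 L) ∧ ∀ t ≥ T0, D.Gam F α t ≤ L + c * t ^ (-δ) := by
  set H := fun t => D.Gam F α (max t T0) - c * (max t T0) ^ (-δ) with hH
  have mH : Monotone H := fun x y h =>
    hm (Set.mem_Ici.2 (le_max_right _ _)) (Set.mem_Ici.2 (le_max_right _ _)) (max_le_max_right _ h)
  have bH : BddAbove (Set.range H) := by
    refine ⟨D.K + |c|, ?_⟩
    rintro _ ⟨t, rfl⟩
    have h1 : 1 ≤ max t T0 := hT.trans (le_max_right _ _)
    have h2 := (abs_le.1 (D.abs_Gam_le hF α h1)).2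
    have h3 : |c * (max t T0) ^ (-δ)| ≤ |c| := by
      rw [abs_mul]
      refine mul_le_of_le_one_right (abs_nonneg _) ?_
      rw [abs_of_nonneg (Real.rpow_nonneg (by linarith) _)]
      exact Real.rpow_le_one_of_one_le_of_nonpos h1 (by linarith)
    have := (abs_le.1 h3).1
    simp only [hH]; linarith
  have lH := tendsto_atTop_ciSup mH bH
  refine ⟨⨆ i, H i, ?_, fun t ht => ?_⟩
  · have l0 : Tendsto (fun t : ℝ => c * t ^ (-δ)) atTop (𝓝 0) := by
      simpa using (tendsto_rpow_neg_atTop hδ).const_mul c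
    have := lH.add l0
    rw [add_zero] at this
    refine this.congr' ?_
    filter_upwards [eventually_ge_atTop T0] with t ht
    simp [hH, max_eq_left ht]
  · have := le_ciSup bH t
    simp only [hH, max_eq_left ht] at this
    linarith

lemma cesaro {f : ℝ → ℝ} {L : ℝ} (hi : ∀ s t : ℝ, 1 ≤ s → s ≤ t → IntervalIntegrable f volume s t)
    (hf : Tendsto f atTop (𝓝 L)) :
    Tendsto (fun t => (∫ τ in (1 : ℝ)..t, f τ) / t) atTop (𝓝 L) := by
  rw [Metric.tendsto_atTop]
  intro ε hε
  obtain ⟨N, hN⟩ := (Metric.tendsto_atTop.1 hf) (ε / 2) (by linarith)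
  set M := max N 1 with hM
  have hM1 : 1 ≤ M := le_max_right _ _
  set A := |∫ τ in (1 : ℝ)..M, (f τ - L)| + |L| with hA
  have hA0 : 0 ≤ A := by positivity
  refine ⟨max M (2 * A / ε + 1), fun t ht => ?_⟩
  have htM : M ≤ t := (le_max_left _ _).trans ht
  have ht2 : 2 * A / ε + 1 ≤ t := (le_max_right _ _).trans ht
  have ht0 : 0 < t := by linarith
  have i1 := hi 1 M le_rfl hM1
  have i2 := hi M t hM1 htM
  have ic : ∀ x y : ℝ, IntervalIntegrable (fun _ : ℝ => L) volume x y := fun x y =>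
    intervalIntegrable_const
  have e : ∫ τ in (1 : ℝ)..t, f τ = (∫ τ in (1 : ℝ)..M, (f τ - L)) + (∫ τ in M..t, (f τ - L)) +
      L * (t - 1) := by
    rw [intervalIntegral.integral_add_adjacent_intervals (i1.sub (ic _ _)) (i2.sub (ic _ _)),
      intervalIntegral.integral_sub (i1.trans i2) (ic _ _)]
    simp; ring
  have b2 : |∫ τ in M..t, (f τ - L)| ≤ ε / 2 * |t - M| := by
    refine intervalIntegral.norm_integral_le_of_norm_le_const (f := fun τ => f τ - L) fun τ hτ => ?_
    rw [Set.uIoc_of_le htM] at hτ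
    have := hN τ ((le_max_left _ _).trans hτ.1.le)
    rw [Real.dist_eq] at this
    exact this.le
  rw [abs_of_nonneg (by linarith : 0 ≤ t - M)] at b2
  have e2 : (∫ τ in (1 : ℝ)..t, f τ) / t - L = ((∫ τ in (1 : ℝ)..M, (f τ - L)) - L +
      (∫ τ in M..t, (f τ - L))) / t := by
    rw [e]; field_simp; ring
  rw [Real.dist_eq, e2, abs_div, abs_of_pos ht0, div_lt_iff₀ ht0]
  have b3 : |(∫ τ in (1 : ℝ)..M, (f τ - L)) - L + (∫ τ in M..t, (f τ - L))| ≤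
      A + ε / 2 * (t - M) :=
    (abs_add_le _ _).trans (add_le_add (abs_sub _ _) b2)
  have b4 : 2 * A < ε * t := by
    have : 2 * A / ε < t := by linarith
    rw [div_lt_iff₀ hε] at this; linarith
  have b5 : 0 < ε / 2 * M := by positivity
  linarith

lemma W1_lim {F : ℝ → ℝ} (hF : IsSmoothChar F) {α L : ℝ} (hα : 0 < α) (hα1 : α < 1)
    (hL : Tendsto (D.Gam F α) atTop (𝓝 L)) :
    Tendsto (fun t => D.W1 t / t) atTop (𝓝 (2 * L)) := by
  have hc := cesaro (fun s t hs hst => (D.gam_ii hF α hs hst).1) hL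
  have l1 : Tendsto (fun t : ℝ => t ^ α / t) atTop (𝓝 0) := by
    have := tendsto_rpow_neg_atTop (by linarith : 0 < 1 - α)
    refine this.congr' ?_
    filter_upwards [eventually_gt_atTop 0] with t ht
    rw [neg_sub, Real.rpow_sub_one ht.ne']
  have l2 : Tendsto (fun t : ℝ => D.Mom F α 1 / t) atTop (𝓝 0) := tendsto_const_nhds.div_atTop tendsto_id
  have l3 : Tendsto (fun t : ℝ => D.K / t) atTop (𝓝 0) := tendsto_const_nhds.div_atTop tendsto_id
  have up : Tendsto (fun t => 2 * ((∫ τ in (1 : ℝ)..t, D.Gam F α τ) / t) + D.Mom F α 1 / t +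
      D.K * (t ^ α / t)) atTop (𝓝 (2 * L)) := by
    simpa using ((hc.const_mul 2).add l2).add (l1.const_mul D.K)
  have lo : Tendsto (fun t => 2 * ((∫ τ in (1 : ℝ)..t, D.Gam F α τ) / t) + D.Mom F α 1 / t -
      D.K * (t ^ α / t)) atTop (𝓝 (2 * L)) := by
    simpa using ((hc.const_mul 2).add l2).sub (l1.const_mul D.K)
  refine tendsto_of_tendsto_of_tendsto_of_le_of_le' lo up ?_ ?_
  · filter_upwards [eventually_ge_atTop 1] with t ht
    have ht0 : 0 < t := by linarith
    have h1 := (D.mom_bounds hF hα le_rfl ht).2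
    have h2 := (D.mom_compare hF α ht).1
    rw [Real.one_rpow] at h1
    have : 2 * ((∫ τ in (1 : ℝ)..t, D.Gam F α τ) / t) + D.Mom F α 1 / t - D.K * (t ^ α / t) =
      (2 * (∫ τ in (1 : ℝ)..t, D.Gam F α τ) + D.Mom F α 1 - D.K * t ^ α) / t := by ring
    rw [this]
    refine div_le_div_of_nonneg_right ?_ ht0.le
    have := D.K_nonneg
    linarith
  · filter_upwards [eventually_ge_atTop 1] with t ht
    have ht0 : 0 < t := by linarith
    have h1 := (D.mom_bounds hF hα le_rfl ht).1
    have h2 := (D.mom_compare hF α ht).2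
    have : 2 * ((∫ τ in (1 : ℝ)..t, D.Gam F α τ) / t) + D.Mom F α 1 / t + D.K * (t ^ α / t) =
      (2 * (∫ τ in (1 : ℝ)..t, D.Gam F α τ) + D.Mom F α 1 + D.K * t ^ α) / t := by ring
    rw [this]
    refine div_le_div_of_nonneg_right ?_ ht0.le
    linarith

/-- decay hypothesis in radial form -/
def HN (F : ℝ → ℝ) (α : ℝ) : Prop := ∃ T0 ≥ 1, ∃ Cn, ∀ t ≥ T0, ∀ r > 0,
  |F (r * t ^ (-α)) * D.n t r| ≤ Cn * t ^ (-(3 / 2) : ℝ)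

theorem concl1 (hN : ∀ α ∈ Set.Ioo (1 / 3 : ℝ) 1, ∀ F, IsSmoothChar F → D.HN F α)
    {F : ℝ → ℝ} (hF : IsSmoothChar F) {α : ℝ} (hα : α ∈ Set.Ioo (1 / 3 : ℝ) 1)
    (h0 : Tendsto (D.Gam F α) atTop (𝓝 0)) {F' : ℝ → ℝ} (hF' : IsSmoothChar F') {α' : ℝ}
    (hα' : α' ∈ Set.Ioo (1 / 3 : ℝ) 1) : Tendsto (D.Gam F' α') atTop (𝓝 0) := by
  obtain ⟨T0, hT, Cn, hn⟩ := hN α' hα' F' hF'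
  have p1 : 0 < α' := by linarith [hα'.1]
  have p2 : 0 < α := by linarith [hα.1]
  have q1 : 0 < 3 * α' - 1 := by linarith [hα'.1]
  have q2 : 0 < 1 - α' := by linarith [hα'.2]
  have hδ : 0 < min (3 * α' - 1) (min (1 / 2) (1 - α')) := by positivity
  obtain ⟨c, _, hm⟩ := D.gam_mono hF' p1 hα'.2 hδ (min_le_left _ _)
    ((min_le_right _ _).trans (min_le_left _ _)) ((min_le_right _ _).trans (min_le_right _ _)) hT hn
  obtain ⟨L, hL, _⟩ := D.gam_limit hF' hT hδ hm
  have := tendsto_nhds_unique (D.W1_lim hF p2 hα.2 h0) (D.W1_lim hF' p1 hα'.2 hL)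
  have hL0 : L = 0 := by linarith
  rwa [hL0] at hL

theorem concl2 {F : ℝ → ℝ} (hF : IsSmoothChar F) (hN : D.HN F (1 / 2))
    (h0 : Tendsto (D.Gam F (1 / 2)) atTop (𝓝 0)) :
    ∃ C, 0 ≤ C ∧ ∀ t ≥ 1, D.W1 t ≤ C * t ^ (1 / 2 : ℝ) := by
  obtain ⟨T0, hT, Cn, hn⟩ := hN
  obtain ⟨c, hc, hm⟩ := D.gam_mono hF (by norm_num : (0 : ℝ) < 1 / 2) (by norm_num)
    (by norm_num : (0 : ℝ) < 1 / 2) (by norm_num) (by norm_num) (by norm_num) hT hn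
  obtain ⟨L, hL, hle⟩ := D.gam_limit hF hT (by norm_num) hm
  have hL0 := tendsto_nhds_unique hL h0
  subst hL0
  have hK := D.K_nonneg
  set M := c + D.K * T0 ^ (1 / 2 : ℝ) with hM
  have hT0 : 0 < T0 := by linarith
  have hp : 0 ≤ D.K * T0 ^ (1 / 2 : ℝ) := mul_nonneg hK (Real.rpow_nonneg hT0.le _)
  have bd : ∀ τ ≥ 1, D.Gam F (1 / 2) τ ≤ M * τ ^ (-(1 / 2) : ℝ) := by
    intro τ hτ
    have hτ0 : 0 < τ := by linarith
    have hr : 0 < τ ^ (-(1 / 2) : ℝ) := Real.rpow_pos_of_pos hτ0 _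
    by_cases h : T0 ≤ τ
    · have := hle τ h
      have := mul_nonneg hp hr.le
      simp only [hM]; linarith
    · push Not at h
      have h1 := (abs_le.1 (D.abs_Gam_le hF (1 / 2) hτ)).2
      have h2 : 1 ≤ T0 ^ (1 / 2 : ℝ) * τ ^ (-(1 / 2) : ℝ) := by
        have : τ ^ (1 / 2 : ℝ) * τ ^ (-(1 / 2) : ℝ) = 1 := by
          rw [← Real.rpow_add hτ0]; norm_num
        refine this.symm.le.trans ?_
        exact mul_le_mul_of_nonneg_right (Real.rpow_le_rpow hτ0.le h.le (by norm_num)) hr.le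
      have h3 := mul_le_mul_of_nonneg_left h2 hK
      have h4 := mul_nonneg hc hr.le
      simp only [hM]; linarith
  have hM0 : 0 ≤ M := add_nonneg hc hp
  refine ⟨|D.Mom F (1 / 2) 1| + 4 * M + D.K, by positivity, fun t ht => ?_⟩
  have ht0 : 0 < t := by linarith
  have h1 := (D.mom_bounds hF (by norm_num : (0 : ℝ) < 1 / 2) le_rfl ht).1
  have h2 := (D.mom_compare hF (1 / 2) ht).2
  have ii : IntervalIntegrable (fun τ : ℝ => M * τ ^ (-(1 / 2) : ℝ)) volume 1 t := by
    refine (intervalIntegral.intervalIntegrable_rpow' (by norm_num)).const_mul _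
  have h3 : ∫ τ in (1 : ℝ)..t, D.Gam F (1 / 2) τ ≤ ∫ τ in (1 : ℝ)..t, M * τ ^ (-(1 / 2) : ℝ) :=
    intervalIntegral.integral_mono_on ht (D.gam_ii hF _ le_rfl ht).1 ii fun τ hτ => bd τ hτ.1
  rw [intervalIntegral.integral_const_mul, integral_rpow (Or.inl (by norm_num))] at h3
  have e : (-(1 / 2) + 1 : ℝ) = 1 / 2 := by norm_num
  rw [e, Real.one_rpow] at h3
  have h4 : 1 ≤ t ^ (1 / 2 : ℝ) := Real.one_le_rpow ht (by norm_num)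
  have h5 := le_abs_self (D.Mom F (1 / 2) 1)
  have h6 := mul_le_mul_of_nonneg_left h4 (abs_nonneg (D.Mom F (1 / 2) 1))
  have h7 : M * ((t ^ (1 / 2 : ℝ) - 1) / (1 / 2)) = 2 * (M * t ^ (1 / 2 : ℝ)) - 2 * M := by ring
  rw [h7] at h3
  linarith

end Dat


/-- open half plane of positive times -/
abbrev OO : Set (ℝ × ℝ) := Set.Ioi 0 ×ˢ Set.univ

lemma isOpen_OO : IsOpen OO := isOpen_Ioi.prod isOpen_univ

/-- space derivative -/
def dX (f : ℝ × ℝ → ℂ) (p : ℝ × ℝ) : ℂ := fderiv ℝ f p (0, 1)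
/-- time derivative -/
def dTm (f : ℝ × ℝ → ℂ) (p : ℝ × ℝ) : ℂ := fderiv ℝ f p (1, 0)

lemma smooth_dir {f : ℝ × ℝ → ℂ} (hf : ContDiffOn ℝ (⊤ : ℕ∞) f OO) (w : ℝ × ℝ) :
    ContDiffOn ℝ (⊤ : ℕ∞) (fun p => fderiv ℝ f p w) OO :=
  (hf.fderiv_of_isOpen isOpen_OO (by exact_mod_cast le_top)).clm_apply contDiffOn_const

lemma hasF {f : ℝ × ℝ → ℂ} (hf : ContDiffOn ℝ (⊤ : ℕ∞) f OO) {t : ℝ} (ht : 0 < t) (r : ℝ) :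
    HasFDerivAt f (fderiv ℝ f (t, r)) (t, r) :=
  ((hf.contDiffAt (isOpen_OO.mem_nhds (⟨ht, trivial⟩ : (t, r) ∈ OO))).differentiableAt (by simp)).hasFDerivAt

lemma dX_has {f : ℝ × ℝ → ℂ} (hf : ContDiffOn ℝ (⊤ : ℕ∞) f OO) {t : ℝ} (ht : 0 < t) (r : ℝ) :
    HasDerivAt (fun s => f (t, s)) (dX f (t, r)) r :=
  HasFDerivAt.comp_hasDerivAt r (hasF hf ht r) ((hasDerivAt_const r t).prodMk (hasDerivAt_id r))

lemma dT_has {f : ℝ × ℝ → ℂ} (hf : ContDiffOn ℝ (⊤ : ℕ∞) f OO) {t : ℝ} (ht : 0 < t) (r : ℝ) :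
    HasDerivAt (fun s => f (s, r)) (dTm f (t, r)) t :=
  HasFDerivAt.comp_hasDerivAt t (hasF hf ht r) ((hasDerivAt_id t).prodMk (hasDerivAt_const t r))

lemma dX_dT {f : ℝ × ℝ → ℂ} (hf : ContDiffOn ℝ (⊤ : ℕ∞) f OO) {t : ℝ} (ht : 0 < t) (r : ℝ) :
    dTm (dX f) (t, r) = dX (dTm f) (t, r) := by
  have hc := hf.contDiffAt (isOpen_OO.mem_nhds (⟨ht, trivial⟩ : (t, r) ∈ OO))
  have hs := hc.isSymmSndFDerivAt (by
    rw [minSmoothness_of_isRCLikeNormedField]; exact WithTop.coe_le_coe.2 le_top)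
  have hd : DifferentiableAt ℝ (fderiv ℝ f) (t, r) :=
    (hc.fderiv_right (m := 1) (WithTop.coe_le_coe.2 (le_top (a := (1 + 1 : ℕ∞))))).differentiableAt (by simp)
  unfold dTm dX
  rw [fderiv_clm_apply hd (differentiableAt_const _), fderiv_clm_apply hd (differentiableAt_const _)]
  simpa using hs (1, 0) (0, 1)

/-- unit vector -/
def e0 : R3 := EuclideanSpace.single 0 1

lemma norm_e0 : ‖e0‖ = 1 := by simp [e0]

/-- radial profile -/
def UU (φ : ℝ → R3 → ℂ) (p : ℝ × ℝ) : ℂ := φ p.1 (p.2 • e0)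

section
variable {N : ℝ → ℝ → ℝ → ℝ} {φ : ℝ → R3 → ℂ}

lemma smooth_UU (h : SolSetting N φ) : ContDiffOn ℝ (⊤ : ℕ∞) (UU φ) OO := by
  have : ContDiff ℝ (⊤ : ℕ∞) (fun p : ℝ × ℝ => (p.1, p.2 • e0)) := by fun_prop
  exact h.smooth.comp this.contDiffOn fun p hp => ⟨Set.mem_Ici.2 (le_of_lt (Set.mem_Ioi.1 hp.1)), trivial⟩

lemma smooth_slice (h : SolSetting N φ) {t : ℝ} (ht : 0 < t) : ContDiff ℝ (⊤ : ℕ∞) (φ t) := by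
  rw [← contDiffOn_univ]
  have : ContDiff ℝ (⊤ : ℕ∞) (fun x : R3 => (t, x)) := by fun_prop
  exact h.smooth.comp this.contDiffOn fun p _ => ⟨ht.le, trivial⟩

lemma radial_UU (h : SolSetting N φ) {t : ℝ} (x : R3) : φ t x = UU φ (t, ‖x‖) := by
  refine h.radial t _ _ ?_
  simp [norm_smul, norm_e0]

lemma radial_dir (h : SolSetting N φ) {t : ℝ} {w : R3} (hw : ‖w‖ = 1) (s : ℝ) :
    φ t (s • w) = UU φ (t, s) := by
  refine h.radial t _ _ ?_
  simp [norm_smul, norm_e0, hw]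

lemma line_deriv (h : SolSetting N φ) {t : ℝ} (ht : 0 < t) (x e : R3) (s : ℝ) :
    HasDerivAt (fun s : ℝ => φ t (x + s • e)) (fderiv ℝ (φ t) (x + s • e) e) s := by
  have h1 : HasDerivAt (fun s : ℝ => x + s • e) e s := by
    simpa using ((hasDerivAt_id s).smul_const e).const_add x
  exact ((smooth_slice h ht).differentiable (by simp) _).hasFDerivAt.comp_hasDerivAt s h1

lemma line_deriv2 (h : SolSetting N φ) {t : ℝ} (ht : 0 < t) (x e : R3) :
    HasDerivAt (fun s : ℝ => fderiv ℝ (φ t) (x + s • e) e)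
      (fderiv ℝ (fun y => fderiv ℝ (φ t) y e) x e) 0 := by
  have h1 : HasDerivAt (fun s : ℝ => x + s • e) e 0 := by
    simpa using ((hasDerivAt_id (0 : ℝ)).smul_const e).const_add x
  have h2 : ContDiff ℝ (⊤ : ℕ∞) (fun y => fderiv ℝ (φ t) y e) :=
    ((smooth_slice h ht).fderiv_right (by exact_mod_cast le_top)).clm_apply contDiff_const
  have h3 := (h2.differentiable (by simp) (x + (0 : ℝ) • e)).hasFDerivAt.comp_hasDerivAt 0 h1
  rw [zero_smul, add_zero] at h3
  exact h3

lemma dX_dir (h : SolSetting N φ) {t : ℝ} (ht : 0 < t) {w : R3} (hw : ‖w‖ = 1) (s : ℝ) :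
    fderiv ℝ (φ t) (s • w) w = dX (UU φ) (t, s) := by
  have h1 := line_deriv h ht 0 w s
  simp only [zero_add, radial_dir h hw] at h1
  exact h1.unique (dX_has (smooth_UU h) ht s)

lemma lap_par (h : SolSetting N φ) {t : ℝ} (ht : 0 < t) (r : ℝ) :
    fderiv ℝ (fun y => fderiv ℝ (φ t) y e0) (r • e0) e0 = dX (dX (UU φ)) (t, r) := by
  have h1 := line_deriv2 h ht (r • e0) e0
  have h2 : (fun s : ℝ => fderiv ℝ (φ t) (r • e0 + s • e0) e0) = fun s => dX (UU φ) (t, r + s) := by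
    funext s
    rw [← add_smul, dX_dir h ht norm_e0]
  rw [h2] at h1
  have h3 := dX_has (smooth_dir (smooth_UU h) (0, 1)) ht r
  have h4 : HasDerivAt (fun s => dX (UU φ) (t, r + s)) (dX (dX (UU φ)) (t, r)) 0 := by
    refine HasDerivAt.comp_const_add (f := fun s => dX (UU φ) (t, s)) r 0 ?_
    rw [add_zero]; exact h3
  exact h1.unique h4

lemma lap_perp (h : SolSetting N φ) {t : ℝ} (ht : 0 < t) {r : ℝ} (hr : 0 < r) {e : R3}
    (he : ∀ s : ℝ, ‖r • e0 + s • e‖ = √(r ^ 2 + s ^ 2)) :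
    fderiv ℝ (fun y => fderiv ℝ (φ t) y e) (r • e0) e = (r⁻¹ : ℝ) * dX (UU φ) (t, r) := by
  have h1 := line_deriv2 h ht (r • e0) e
  have h2 : (fun s : ℝ => fderiv ℝ (φ t) (r • e0 + s • e) e) =
      fun s : ℝ => (s : ℂ) * ((((√(r ^ 2 + s ^ 2))⁻¹ : ℝ) : ℂ) * dX (UU φ) (t, √(r ^ 2 + s ^ 2))) := by
    funext s
    have hp : 0 < r ^ 2 + s ^ 2 := by positivity
    have a1 := line_deriv h ht (r • e0) e s
    have a2 : (fun s : ℝ => φ t (r • e0 + s • e)) = fun s => UU φ (t, √(r ^ 2 + s ^ 2)) := by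
      funext s; rw [radial_UU h, he]
    rw [a2] at a1
    have a3 : HasDerivAt (fun s : ℝ => √(r ^ 2 + s ^ 2)) (s / √(r ^ 2 + s ^ 2)) s := by
      have := ((((hasDerivAt_id s).pow 2).const_add (r ^ 2)).sqrt hp.ne')
      refine this.congr_deriv ?_
      simp; field_simp
    have a4 := (dX_has (smooth_UU h) ht (√(r ^ 2 + s ^ 2))).scomp s a3
    have := a1.unique a4
    rw [this, Complex.real_smul]
    push_cast; ring
  rw [h2] at h1
  set G : ℝ → ℂ := fun s => (((√(r ^ 2 + s ^ 2))⁻¹ : ℝ) : ℂ) * dX (UU φ) (t, √(r ^ 2 + s ^ 2)) with hG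
  have cG : ContinuousAt G 0 := by
    have c1 : Continuous fun s : ℝ => √(r ^ 2 + s ^ 2) := by fun_prop
    have c2 : Continuous fun s : ℝ => (√(r ^ 2 + s ^ 2))⁻¹ :=
      c1.inv₀ fun s => (Real.sqrt_pos.2 (by positivity)).ne'
    have c3 : Continuous fun s : ℝ => dX (UU φ) (t, s) := continuous_iff_continuousAt.2 fun s =>
      (dX_has (smooth_dir (smooth_UU h) (0, 1)) ht s).continuousAt
    exact ((Complex.continuous_ofReal.comp c2).mul (c3.comp c1)).continuousAt
  have h4 : HasDerivAt (fun s : ℝ => (s : ℂ) * G s) (G 0) 0 := by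
    rw [hasDerivAt_iff_tendsto_slope]
    refine (cG.tendsto.mono_left nhdsWithin_le_nhds).congr' ?_
    filter_upwards [self_mem_nhdsWithin] with s hs
    have : (s : ℂ) ≠ 0 := by exact_mod_cast hs
    simp [slope_def_module, this]
  rw [h1.unique h4, hG]
  simp [Real.sqrt_sq hr.le]

lemma pde_UU (h : SolSetting N φ) {t : ℝ} (ht : 0 < t) {r : ℝ} (hr : 0 < r) :
    Complex.I * dTm (UU φ) (t, r) + (dX (dX (UU φ)) (t, r) + 2 * (r⁻¹ : ℝ) * dX (UU φ) (t, r)) =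
      (N ‖UU φ (t, r)‖ r t : ℂ) * UU φ (t, r) := by
  have h0 := h.eqn t ht.le (r • e0)
  have h1 : deriv (fun s => φ s (r • e0)) t = dTm (UU φ) (t, r) := (dT_has (smooth_UU h) ht r).deriv
  have hn : ‖r • e0‖ = r := by simp [norm_smul, norm_e0, abs_of_pos hr]
  have hp : ∀ j : Fin 3, j ≠ 0 → ∀ s : ℝ,
      ‖r • e0 + s • (EuclideanSpace.single j 1 : R3)‖ = √(r ^ 2 + s ^ 2) := by
    intro j hj s
    rw [EuclideanSpace.norm_eq]
    congr 1
    fin_cases j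
    · exact absurd rfl hj
    · simp [Fin.sum_univ_three, e0]
    · simp [Fin.sum_univ_three, e0]
  rw [h1, hn] at h0
  unfold laplacian at h0
  rw [Fin.sum_univ_three, lap_perp h ht hr (hp 1 (by decide)), lap_perp h ht hr (hp 2 (by decide))] at h0
  have h2 := lap_par h ht r
  unfold e0 at h2
  have h3 : ((r • e0 : R3)) = r • EuclideanSpace.single 0 1 := rfl
  rw [h3, h2] at h0
  have h4 : φ t (r • EuclideanSpace.single 0 1) = UU φ (t, r) := rfl
  rw [h4] at h0
  rw [← h0]; ring

end


/-- area of the unit sphere -/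
def kap : ℝ := 3 * (volume : Measure R3).real (Metric.ball 0 1)

lemma kap_pos : 0 < kap := by
  unfold kap
  have : 0 < (volume : Measure R3).real (Metric.ball 0 1) :=
    ENNReal.toReal_pos (Metric.measure_ball_pos _ _ one_pos).ne' measure_ball_lt_top.ne
  positivity

lemma rad_int {E : Type*} [NormedAddCommGroup E] [NormedSpace ℝ E] (f : ℝ → E) :
    Integrable (fun x : R3 => f ‖x‖) ↔ IntegrableOn (fun r : ℝ => r ^ 2 • f r) (Set.Ioi 0) := by
  have := MeasureTheory.integrable_fun_norm_addHaar (volume : Measure R3) (f := f)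
  simpa using this

lemma rad_integral {E : Type*} [NormedAddCommGroup E] [NormedSpace ℝ E] (f : ℝ → E) :
    ∫ x : R3, f ‖x‖ = kap • ∫ r in Set.Ioi (0 : ℝ), r ^ 2 • f r := by
  have := MeasureTheory.integral_fun_norm_addHaar (volume : Measure R3) f
  rw [this, kap, mul_smul]
  simp only [finrank_euclideanSpace, Fintype.card_fin]
  module

section
variable {N : ℝ → ℝ → ℝ → ℝ} {φ : ℝ → R3 → ℂ}

lemma grad_ge (h : SolSetting N φ) {t : ℝ} (ht : 0 < t) (x : R3) :
    ‖dX (UU φ) (t, ‖x‖)‖ ^ 2 ≤ ‖fderiv ℝ (φ t) x‖ ^ 2 := by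
  refine pow_le_pow_left₀ (norm_nonneg _) ?_ 2
  obtain ⟨w, hw, hx⟩ : ∃ w : R3, ‖w‖ = 1 ∧ ‖x‖ • w = x := by
    by_cases h0 : x = 0
    · exact ⟨e0, norm_e0, by simp [h0]⟩
    · have : ‖x‖ ≠ 0 := norm_ne_zero_iff.2 h0
      exact ⟨‖x‖⁻¹ • x, by simp [norm_smul, this], by rw [smul_smul, mul_inv_cancel₀ this, one_smul]⟩
  rw [← dX_dir h ht hw, hx]
  simpa [hw] using (fderiv ℝ (φ t) x).le_opNorm w

lemma cU (h : SolSetting N φ) : ContinuousOn (UU φ) QQ :=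
  (smooth_UU h).continuousOn.mono (Set.prod_mono_right (Set.subset_univ _))
lemma cUX (h : SolSetting N φ) : ContinuousOn (dX (UU φ)) QQ :=
  (smooth_dir (smooth_UU h) (0, 1)).continuousOn.mono (Set.prod_mono_right (Set.subset_univ _))
lemma cUXX (h : SolSetting N φ) : ContinuousOn (dX (dX (UU φ))) QQ :=
  (smooth_dir (smooth_dir (smooth_UU h) (0, 1)) (0, 1)).continuousOn.mono
    (Set.prod_mono_right (Set.subset_univ _))
lemma cUT (h : SolSetting N φ) : ContinuousOn (dTm (UU φ)) QQ :=
  (smooth_dir (smooth_UU h) (1, 0)).continuousOn.mono (Set.prod_mono_right (Set.subset_univ _))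
lemma cUTX (h : SolSetting N φ) : ContinuousOn (dX (dTm (UU φ))) QQ :=
  (smooth_dir (smooth_dir (smooth_UU h) (1, 0)) (0, 1)).continuousOn.mono
    (Set.prod_mono_right (Set.subset_univ _))

lemma c_t (h : SolSetting N φ) {t : ℝ} (ht : 0 < t) : Continuous (fun r => UU φ (t, r)) :=
  continuous_iff_continuousAt.2 fun s => (dX_has (smooth_UU h) ht s).continuousAt
lemma c_tX (h : SolSetting N φ) {t : ℝ} (ht : 0 < t) : Continuous (fun r => dX (UU φ) (t, r)) :=
  continuous_iff_continuousAt.2 fun s =>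
    (dX_has (smooth_dir (smooth_UU h) (0, 1)) ht s).continuousAt

lemma i_u (h : SolSetting N φ) {t : ℝ} (ht : 0 < t) :
    IntegrableOn (fun r => r ^ 2 * ‖UU φ (t, r)‖ ^ 2) (Set.Ioi 0) := by
  have := h.l2 t ht.le
  simp only [radial_UU h] at this
  exact (rad_int (fun r => ‖UU φ (t, r)‖ ^ 2)).1 this

lemma i_w (h : SolSetting N φ) {t : ℝ} (ht : 0 < t) :
    IntegrableOn (fun r => r * (r ^ 2 * ‖UU φ (t, r)‖ ^ 2)) (Set.Ioi 0) := by
  have := h.wt_l2 t ht.le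
  simp only [radial_UU h] at this
  have := ((rad_int (fun r => (1 + r) * ‖UU φ (t, r)‖ ^ 2)).1 this).sub (i_u h ht)
  refine this.congr (Eventually.of_forall fun r => ?_)
  simp only [smul_eq_mul, Pi.sub_apply]; ring

lemma i_ux3 (h : SolSetting N φ) {t : ℝ} (ht : 0 < t) :
    Integrable (fun x : R3 => ‖dX (UU φ) (t, ‖x‖)‖ ^ 2) := by
  refine (h.grad_l2 t ht.le).mono' ?_ (Eventually.of_forall fun x => ?_)
  · exact (((c_tX h ht).comp continuous_norm).norm.pow 2).aestronglyMeasurable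
  · rw [Real.norm_of_nonneg (by positivity)]
    exact grad_ge h ht x

lemma i_ux (h : SolSetting N φ) {t : ℝ} (ht : 0 < t) :
    IntegrableOn (fun r => r ^ 2 * ‖dX (UU φ) (t, r)‖ ^ 2) (Set.Ioi 0) :=
  (rad_int (fun r => ‖dX (UU φ) (t, r)‖ ^ 2)).1 (i_ux3 h ht)

lemma h1_bd (h : SolSetting N φ) {t : ℝ} (ht : 0 < t) :
    kap * (∫ r in Set.Ioi (0 : ℝ), r ^ 2 * ‖UU φ (t, r)‖ ^ 2) +
    kap * (∫ r in Set.Ioi (0 : ℝ), r ^ 2 * ‖dX (UU φ) (t, r)‖ ^ 2) ≤ h.H1.choose := by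
  have h0 := h.H1.choose_spec t ht.le
  have h1 := rad_integral (fun r => ‖UU φ (t, r)‖ ^ 2)
  have h2 := rad_integral (fun r => ‖dX (UU φ) (t, r)‖ ^ 2)
  simp only [smul_eq_mul] at h1 h2
  rw [← h1, ← h2]
  simp only [← radial_UU h]
  refine le_trans (add_le_add le_rfl ?_) h0
  exact integral_mono (i_ux3 h ht) (h.grad_l2 t ht.le) fun x => grad_ge h ht x

lemma sq_re_im (z : ℂ) : z.re ^ 2 + z.im ^ 2 = ‖z‖ ^ 2 := by
  rw [Complex.sq_norm, Complex.normSq_apply]; ring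

lemma rho_id (r : ℝ) (z : ℂ) : ((r : ℂ) * z).re ^ 2 + ((r : ℂ) * z).im ^ 2 = r ^ 2 * ‖z‖ ^ 2 := by
  rw [sq_re_im, norm_mul, mul_pow]; simp

lemma en_le {r : ℝ} (hr : 1 / 2 ≤ r) (z w : ℂ) :
    (z + (r : ℂ) * w).re ^ 2 + (z + (r : ℂ) * w).im ^ 2 ≤
      8 * (r ^ 2 * ‖z‖ ^ 2) + 2 * (r ^ 2 * ‖w‖ ^ 2) := by
  rw [sq_re_im]
  have h1 : ‖z + (r : ℂ) * w‖ ≤ ‖z‖ + r * ‖w‖ := by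
    refine (norm_add_le _ _).trans ?_
    rw [norm_mul, Complex.norm_real, Real.norm_of_nonneg (by linarith)]
  have h2 : ‖z + (r : ℂ) * w‖ ^ 2 ≤ (‖z‖ + r * ‖w‖) ^ 2 := pow_le_pow_left₀ (norm_nonneg _) h1 2
  have h3 : (1 : ℝ) ≤ 4 * r ^ 2 := by nlinarith
  have h4 := mul_le_mul_of_nonneg_right h3 (sq_nonneg ‖z‖)
  nlinarith [sq_nonneg (‖z‖ - r * ‖w‖)]

lemma re_has {f : ℝ → ℂ} {f' : ℂ} {x : ℝ} (h : HasDerivAt f f' x) :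
    HasDerivAt (fun s => (f s).re) f'.re x := Complex.reCLM.hasFDerivAt.comp_hasDerivAt x h
lemma im_has {f : ℝ → ℂ} {f' : ℂ} {x : ℝ} (h : HasDerivAt f f' x) :
    HasDerivAt (fun s => (f s).im) f'.im x := Complex.imCLM.hasFDerivAt.comp_hasDerivAt x h

lemma rmul_has {f : ℝ → ℂ} {f' : ℂ} {x : ℝ} (h : HasDerivAt f f' x) :
    HasDerivAt (fun s : ℝ => (s : ℂ) * f s) (f x + (x : ℂ) * f') x := by
  have := (Complex.ofRealCLM.hasDerivAt (x := x)).mul h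
  refine this.congr_deriv ?_
  simp

/-- the reduced data -/
def mkDat (h : SolSetting N φ) : Dat where
  a t r := ((r : ℂ) * UU φ (t, r)).re
  b t r := ((r : ℂ) * UU φ (t, r)).im
  aT t r := ((r : ℂ) * dTm (UU φ) (t, r)).re
  bT t r := ((r : ℂ) * dTm (UU φ) (t, r)).im
  a1 t r := (UU φ (t, r) + (r : ℂ) * dX (UU φ) (t, r)).re
  b1 t r := (UU φ (t, r) + (r : ℂ) * dX (UU φ) (t, r)).im
  a2 t r := (dX (UU φ) (t, r) + (dX (UU φ) (t, r) + (r : ℂ) * dX (dX (UU φ)) (t, r))).re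
  b2 t r := (dX (UU φ) (t, r) + (dX (UU φ) (t, r) + (r : ℂ) * dX (dX (UU φ)) (t, r))).im
  aT1 t r := (dTm (UU φ) (t, r) + (r : ℂ) * dX (dTm (UU φ)) (t, r)).re
  bT1 t r := (dTm (UU φ) (t, r) + (r : ℂ) * dX (dTm (UU φ)) (t, r)).im
  n t r := N ‖UU φ (t, r)‖ r t
  K := 9 * (kap⁻¹ * h.H1.choose)
  c_a := Complex.continuous_re.comp_continuousOn
    ((Complex.continuous_ofReal.comp continuous_snd).continuousOn.mul (cU h))
  c_b := Complex.continuous_im.comp_continuousOn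
    ((Complex.continuous_ofReal.comp continuous_snd).continuousOn.mul (cU h))
  c_aT := Complex.continuous_re.comp_continuousOn
    ((Complex.continuous_ofReal.comp continuous_snd).continuousOn.mul (cUT h))
  c_bT := Complex.continuous_im.comp_continuousOn
    ((Complex.continuous_ofReal.comp continuous_snd).continuousOn.mul (cUT h))
  c_a1 := Complex.continuous_re.comp_continuousOn
    ((cU h).add ((Complex.continuous_ofReal.comp continuous_snd).continuousOn.mul (cUX h)))
  c_b1 := Complex.continuous_im.comp_continuousOn
    ((cU h).add ((Complex.continuous_ofReal.comp continuous_snd).continuousOn.mul (cUX h)))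
  c_a2 := Complex.continuous_re.comp_continuousOn ((cUX h).add
    ((cUX h).add ((Complex.continuous_ofReal.comp continuous_snd).continuousOn.mul (cUXX h))))
  c_b2 := Complex.continuous_im.comp_continuousOn ((cUX h).add
    ((cUX h).add ((Complex.continuous_ofReal.comp continuous_snd).continuousOn.mul (cUXX h))))
  c_aT1 := Complex.continuous_re.comp_continuousOn
    ((cUT h).add ((Complex.continuous_ofReal.comp continuous_snd).continuousOn.mul (cUTX h)))
  c_bT1 := Complex.continuous_im.comp_continuousOn
    ((cUT h).add ((Complex.continuous_ofReal.comp continuous_snd).continuousOn.mul (cUTX h)))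
  d_aT t ht r _ := re_has ((dT_has (smooth_UU h) ht r).const_mul (r : ℂ))
  d_bT t ht r _ := im_has ((dT_has (smooth_UU h) ht r).const_mul (r : ℂ))
  d_a1 t ht r _ := re_has (rmul_has (dX_has (smooth_UU h) ht r))
  d_b1 t ht r _ := im_has (rmul_has (dX_has (smooth_UU h) ht r))
  d_a2 t ht r _ := re_has ((dX_has (smooth_UU h) ht r).add
    (rmul_has (dX_has (smooth_dir (smooth_UU h) (0, 1)) ht r)))
  d_b2 t ht r _ := im_has ((dX_has (smooth_UU h) ht r).add
    (rmul_has (dX_has (smooth_dir (smooth_UU h) (0, 1)) ht r)))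
  d_a1T t ht r _ := by
    rw [← dX_dT (smooth_UU h) ht r]
    exact re_has ((dT_has (smooth_UU h) ht r).add
      ((dT_has (smooth_dir (smooth_UU h) (0, 1)) ht r).const_mul (r : ℂ)))
  d_b1T t ht r _ := by
    rw [← dX_dT (smooth_UU h) ht r]
    exact im_has ((dT_has (smooth_UU h) ht r).add
      ((dT_has (smooth_dir (smooth_UU h) (0, 1)) ht r).const_mul (r : ℂ)))
  d_aT1 t ht r _ := re_has (rmul_has (dX_has (smooth_dir (smooth_UU h) (1, 0)) ht r))
  d_bT1 t ht r _ := im_has (rmul_has (dX_has (smooth_dir (smooth_UU h) (1, 0)) ht r))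
  pde_a t ht r hr := by
    have h0 := congrArg Complex.im (pde_UU h ht hr)
    simp [Complex.add_im, Complex.mul_im] at h0
    have h1 := congrArg (fun y => r * y) h0
    have h2 : r * (2 * r⁻¹ * (dX (UU φ) (t, r)).im) = 2 * (dX (UU φ) (t, r)).im := by
      field_simp
    simp
    linarith
  pde_b t ht r hr := by
    have h0 := congrArg Complex.re (pde_UU h ht hr)
    simp [Complex.add_re, Complex.mul_re] at h0
    have h1 := congrArg (fun y => r * y) h0
    have h2 : r * (2 * r⁻¹ * (dX (UU φ) (t, r)).re) = 2 * (dX (UU φ) (t, r)).re := by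
      field_simp
    simp
    linarith
  int_w t ht := by
    simp only [rho_id]
    exact (i_w h (by linarith)).mono_set (Set.Ioi_subset_Ioi (by norm_num))
  int_rho t ht := by
    simp only [rho_id]
    exact (i_u h (by linarith)).mono_set (Set.Ioi_subset_Ioi (by norm_num))
  int_e t ht := by
    have ht0 : 0 < t := by linarith
    have hI : IntegrableOn (fun r => 8 * (r ^ 2 * ‖UU φ (t, r)‖ ^ 2) +
        2 * (r ^ 2 * ‖dX (UU φ) (t, r)‖ ^ 2)) (Set.Ioi 0) :=
      ((i_u h ht0).const_mul 8).add ((i_ux h ht0).const_mul 2)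
    refine Integrable.mono' (hI.mono_set (Set.Ioi_subset_Ioi (by norm_num))) ?_
      ((ae_restrict_iff' measurableSet_Ioi).2 (Eventually.of_forall fun r hr => ?_))
    · have c1 := c_t h ht0
      have c2 := c_tX h ht0
      exact Continuous.aestronglyMeasurable (by fun_prop)
    · rw [Real.norm_of_nonneg (by positivity)]
      exact en_le (le_of_lt hr) _ _
  bd t ht := by
    have ht0 : 0 < t := by linarith
    have hb := h1_bd h ht0
    set A := ∫ r in Set.Ioi (0 : ℝ), r ^ 2 * ‖UU φ (t, r)‖ ^ 2
    set B := ∫ r in Set.Ioi (0 : ℝ), r ^ 2 * ‖dX (UU φ) (t, r)‖ ^ 2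
    have hB0 : 0 ≤ B := setIntegral_nonneg measurableSet_Ioi fun r _ => by positivity
    have hI : IntegrableOn (fun r => 9 * (r ^ 2 * ‖UU φ (t, r)‖ ^ 2) +
        2 * (r ^ 2 * ‖dX (UU φ) (t, r)‖ ^ 2)) (Set.Ioi 0) :=
      ((i_u h ht0).const_mul 9).add ((i_ux h ht0).const_mul 2)
    have e : ∫ r in Set.Ioi (0 : ℝ), (9 * (r ^ 2 * ‖UU φ (t, r)‖ ^ 2) +
        2 * (r ^ 2 * ‖dX (UU φ) (t, r)‖ ^ 2)) = 9 * A + 2 * B := by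
      rw [integral_add ((i_u h ht0).const_mul 9) ((i_ux h ht0).const_mul 2), integral_const_mul,
        integral_const_mul]
    have hle : A + B ≤ kap⁻¹ * h.H1.choose := by
      rw [inv_mul_eq_div, le_div_iff₀ kap_pos]; linarith
    refine le_trans ?_ (by linarith : 9 * A + 2 * B ≤ _)
    rw [← e]
    refine le_trans ?_ (setIntegral_mono_set hI (Eventually.of_forall fun r => by positivity)
      (Set.Ioi_subset_Ioi (by norm_num : (0 : ℝ) ≤ 1 / 2)).eventuallyLE)
    refine integral_mono_of_nonneg (Eventually.of_forall fun r => by positivity)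
      (hI.mono_set (Set.Ioi_subset_Ioi (by norm_num)))
      ((ae_restrict_iff' measurableSet_Ioi).2 (Eventually.of_forall fun r hr => ?_))
    have h1 := en_le (le_of_lt hr) (UU φ (t, r)) (dX (UU φ) (t, r))
    have h2 := rho_id r (UU φ (t, r))
    simp only []
    linarith

end


lemma grad_norm {x : R3} (hx : x ≠ 0) : HasGradientAt (fun y : R3 => ‖y‖) (‖x‖⁻¹ • x) x := by
  rw [hasGradientAt_iff_hasFDerivAt]
  have hn : 0 < ‖x‖ := norm_pos_iff.2 hx
  have h1 := (hasStrictFDerivAt_norm_sq x).hasFDerivAt.sqrt (by positivity)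
  simp only [Real.sqrt_sq (norm_nonneg _)] at h1
  refine h1.congr_fderiv ?_
  ext y
  simp [inner_smul_left]
  field_simp

lemma grad_g {g : R3 → ℝ} {β : ℝ → ℝ} (hg : GoodG g β) {x : R3} (hx : 2 < ‖x‖) :
    gradient g x = ‖x‖⁻¹ • x := by
  have hx0 : x ≠ 0 := norm_pos_iff.1 (by linarith)
  have he : g =ᶠ[𝓝 x] fun y => ‖y‖ := by
    filter_upwards [continuous_norm.continuousAt.eventually (lt_mem_nhds hx)] with y hy
    rw [hg.g_eq, hg.beta_eq_id _ (le_of_lt hy)]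
  exact ((grad_norm hx0).congr_of_eventuallyEq he).gradient

lemma F_small {F : ℝ → ℝ} (hF : IsSmoothChar F) {α t r : ℝ} (ht : 0 < t) (hT : 4 ≤ t ^ α)
    (hr : r ≤ 2) : F (r * t ^ (-α)) = 0 := by
  refine hF.2.2.1 _ ?_
  rw [Real.rpow_neg ht.le, ← div_eq_mul_inv, div_le_iff₀ (by linarith)]
  linarith

lemma F_g {g : R3 → ℝ} {β : ℝ → ℝ} (hg : GoodG g β) {F : ℝ → ℝ} (hF : IsSmoothChar F) {α t : ℝ}
    (ht : 0 < t) (hT : 4 ≤ t ^ α) (x : R3) : F (g x / t ^ α) = F (‖x‖ * t ^ (-α)) := by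
  by_cases h : ‖x‖ ≤ 2
  · rw [F_small hF ht hT h]
    refine hF.2.2.1 _ ?_
    have h1 : g x ≤ 2 := by
      rw [hg.g_eq]
      have := hg.mono_beta (Set.mem_Ici.2 (norm_nonneg x))
        (Set.mem_Ici.2 (by norm_num : (0 : ℝ) ≤ 2)) h
      rwa [hg.beta_eq_id 2 le_rfl] at this
    rw [div_le_iff₀ (by linarith)]; linarith
  · push Not at h
    rw [hg.g_eq, hg.beta_eq_id _ h.le, Real.rpow_neg ht.le, div_eq_mul_inv]

section
variable {N : ℝ → ℝ → ℝ → ℝ} {φ : ℝ → R3 → ℂ}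

lemma integrand {g : R3 → ℝ} {β : ℝ → ℝ} (hg : GoodG g β) (h : SolSetting N φ) {F : ℝ → ℝ}
    (hF : IsSmoothChar F) (S : SCD F) {α t : ℝ} (ht : 0 < t) (hT : 4 ≤ t ^ α) (x : R3) :
    (starRingEnd ℂ) ((F (g x / t ^ α) : ℂ) * φ t x) *
      fderiv ℝ (fun y => (F (g y / t ^ α) : ℂ) * φ t y) x (gradient g x) =
    (F (‖x‖ * t ^ (-α)) : ℂ) * (starRingEnd ℂ) (UU φ (t, ‖x‖)) *
      (((S.f1 (‖x‖ * t ^ (-α)) * t ^ (-α) : ℝ) : ℂ) * UU φ (t, ‖x‖) +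
        (F (‖x‖ * t ^ (-α)) : ℂ) * dX (UU φ) (t, ‖x‖)) := by
  by_cases hx : ‖x‖ ≤ 2
  · rw [F_g hg hF ht hT, F_small hF ht hT hx]; simp
  push Not at hx
  have hx0 : 0 < ‖x‖ := by linarith
  simp only [F_g hg hF ht hT]
  rw [grad_g hg hx]
  set w := ‖x‖⁻¹ • x with hw
  have hw1 : ‖w‖ = 1 := by simp [hw, norm_smul, hx0.ne']
  have hxw : ‖x‖ • w = x := by rw [hw, smul_smul, mul_inv_cancel₀ hx0.ne', one_smul]
  set ψ : R3 → ℂ := fun y => (F (‖y‖ * t ^ (-α)) : ℂ) * φ t y with hψ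
  have hd : DifferentiableAt ℝ ψ x := by
    have d1 : DifferentiableAt ℝ (fun y : R3 => ‖y‖ * t ^ (-α)) x :=
      ((grad_norm (norm_pos_iff.1 hx0)).differentiableAt).mul_const _
    have d2 : DifferentiableAt ℝ (fun y : R3 => F (‖y‖ * t ^ (-α))) x :=
      (S.d1 _).differentiableAt.comp x d1
    have d3 : DifferentiableAt ℝ (fun y : R3 => (F (‖y‖ * t ^ (-α)) : ℂ)) x :=
      Complex.ofRealCLM.differentiableAt.comp x d2
    exact d3.mul ((smooth_slice h ht).differentiable (by simp) x)
  have l1 : HasDerivAt (fun s : ℝ => s • w) w ‖x‖ := by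
    simpa using (hasDerivAt_id ‖x‖).smul_const w
  have hd' : HasFDerivAt ψ (fderiv ℝ ψ x) (‖x‖ • w) := by rw [hxw]; exact hd.hasFDerivAt
  have l2 := hd'.comp_hasDerivAt ‖x‖ l1
  have l3 : HasDerivAt (fun s : ℝ => (F (s * t ^ (-α)) : ℂ) * UU φ (t, s))
      (((S.f1 (‖x‖ * t ^ (-α)) * t ^ (-α) : ℝ) : ℂ) * UU φ (t, ‖x‖) +
        (F (‖x‖ * t ^ (-α)) : ℂ) * dX (UU φ) (t, ‖x‖)) ‖x‖ := by
    have e1 : HasDerivAt (fun s : ℝ => s * t ^ (-α)) (t ^ (-α)) ‖x‖ := by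
      simpa using (hasDerivAt_id ‖x‖).mul_const (t ^ (-α))
    exact (((S.d1 _).comp ‖x‖ e1).ofReal_comp).mul (dX_has (smooth_UU h) ht ‖x‖)
  have l4 : (ψ ∘ fun s : ℝ => s • w) =ᶠ[𝓝 ‖x‖] fun s : ℝ => (F (s * t ^ (-α)) : ℂ) * UU φ (t, s) := by
    filter_upwards [lt_mem_nhds hx0] with s hs
    simp only [hψ, Function.comp, radial_dir h hw1, norm_smul, hw1, mul_one, Real.norm_of_nonneg hs.le]
  rw [(l2.congr_of_eventuallyEq l4.symm).unique l3, ← radial_UU h]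
  simp

lemma gamma_conv {g : R3 → ℝ} {β : ℝ → ℝ} (hg : GoodG g β) (h : SolSetting N φ) {F : ℝ → ℝ}
    (hF : IsSmoothChar F) {α t : ℝ} (hα : 0 < α) (ht : 1 ≤ t) (hT : 4 ≤ t ^ α) :
    GammaF g φ F α t = kap * (mkDat h).Gam F α t := by
  obtain ⟨S⟩ := scd_exists hF
  have ht0 : 0 < t := by linarith
  have hl0 : 0 < t ^ (-α) := Real.rpow_pos_of_pos ht0 _
  have hl1 : t ^ (-α) ≤ 1 := Real.rpow_le_one_of_one_le_of_nonpos ht (by linarith)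
  unfold GammaF gammaExp
  simp only [integrand hg h hF S ht0 hT]
  set H : ℝ → ℂ := fun r => (F (r * t ^ (-α)) : ℂ) * (starRingEnd ℂ) (UU φ (t, r)) *
      (((S.f1 (r * t ^ (-α)) * t ^ (-α) : ℝ) : ℂ) * UU φ (t, r) +
        (F (r * t ^ (-α)) : ℂ) * dX (UU φ) (t, r)) with hH
  have e1 : ∫ x : R3, H ‖x‖ = kap • ∫ r in Set.Ioi (0 : ℝ), r ^ 2 • H r := rad_integral H
  have cH : Continuous H := by
    have c1 := c_t h ht0
    have c2 := c_tX h ht0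
    have c3 := S.cF
    have c4 := S.c1
    have c5 : Continuous fun r => (starRingEnd ℂ) (UU φ (t, r)) := Complex.continuous_conj.comp c1
    fun_prop
  have hI : IntegrableOn (fun r : ℝ => r ^ 2 • H r) (Set.Ioi 0) := by
    have hb : IntegrableOn (fun r => (S.C + 1) * (r ^ 2 * ‖UU φ (t, r)‖ ^ 2) +
        1 * (r ^ 2 * ‖dX (UU φ) (t, r)‖ ^ 2)) (Set.Ioi 0) :=
      ((i_u h ht0).const_mul _).add ((i_ux h ht0).const_mul _)
    refine Integrable.mono' hb (Continuous.aestronglyMeasurable (by fun_prop))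
      (Eventually.of_forall fun r => ?_)
    rw [norm_smul, Real.norm_of_nonneg (sq_nonneg r)]
    set A := ‖UU φ (t, r)‖ with hA
    set B := ‖dX (UU φ) (t, r)‖ with hB
    have hA0 : 0 ≤ A := norm_nonneg _
    have hB0 : 0 ≤ B := norm_nonneg _
    have hf := hF.2.2.2.2 (r * t ^ (-α))
    have n1 : ‖H r‖ ≤ A * (S.C * A + B) := by
      simp only [hH]
      rw [norm_mul, norm_mul, Complex.norm_real, Real.norm_of_nonneg hf.1, RCLike.norm_conj]
      refine mul_le_mul (mul_le_of_le_one_left hA0 hf.2) ?_ (norm_nonneg _) hA0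
      refine (norm_add_le _ _).trans (add_le_add ?_ ?_)
      · rw [norm_mul, Complex.norm_real, norm_mul, Real.norm_eq_abs, Real.norm_of_nonneg hl0.le]
        refine mul_le_mul_of_nonneg_right ?_ hA0
        calc _ ≤ S.C * 1 := mul_le_mul (S.b1 _) hl1 hl0.le (by linarith [S.C1])
          _ = S.C := mul_one _
      · rw [norm_mul, Complex.norm_real, Real.norm_of_nonneg hf.1]
        exact mul_le_of_le_one_left hB0 hf.2
    have n2 : A * (S.C * A + B) ≤ (S.C + 1) * A ^ 2 + B ^ 2 := by
      nlinarith [sq_nonneg (A - B), sq_nonneg A, sq_nonneg B]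
    calc r ^ 2 * ‖H r‖ ≤ r ^ 2 * ((S.C + 1) * A ^ 2 + B ^ 2) :=
          mul_le_mul_of_nonneg_left (n1.trans n2) (sq_nonneg r)
      _ = _ := by ring
  have e2 : (∫ r in Set.Ioi (0 : ℝ), r ^ 2 • H r).im = ∫ r in Set.Ioi (0 : ℝ), (r ^ 2 • H r).im :=
    (Complex.imCLM.integral_comp_comm hI).symm
  have e3 : ∀ r : ℝ, (r ^ 2 • H r).im = F (r * t ^ (-α)) ^ 2 * (mkDat h).J t r := by
    intro r
    rw [Complex.smul_im, smul_eq_mul]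
    simp only [hH, Dat.J, mkDat]
    simp
    ring
  rw [e1, Complex.smul_im, e2, smul_eq_mul]
  simp only [e3]
  congr 1
  unfold Dat.Gam
  refine setIntegral_eq_of_subset_of_forall_sdiff_eq_zero measurableSet_Ioi
    (Set.Ioi_subset_Ioi (by norm_num)) fun r hr => ?_
  have : r ≤ 1 / 2 := not_lt.1 hr.2
  rw [F_small hF ht0 hT (by linarith)]; simp

lemma ev_four {α : ℝ} (hα : 0 < α) : ∃ T ≥ (1 : ℝ), ∀ t ≥ T, 4 ≤ t ^ α := by
  obtain ⟨T, hT⟩ := eventually_atTop.1 ((tendsto_rpow_atTop hα).eventually_ge_atTop 4)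
  exact ⟨max T 1, le_max_right _ _, fun t ht => hT t ((le_max_left _ _).trans ht)⟩

lemma lim_iff {g : R3 → ℝ} {β : ℝ → ℝ} (hg : GoodG g β) (h : SolSetting N φ) {F : ℝ → ℝ}
    (hF : IsSmoothChar F) {α : ℝ} (hα : 0 < α) :
    Tendsto (fun t => GammaF g φ F α t) atTop (𝓝 0) ↔ Tendsto ((mkDat h).Gam F α) atTop (𝓝 0) := by
  obtain ⟨T, hT1, hT⟩ := ev_four hα
  have he : (fun t => GammaF g φ F α t) =ᶠ[atTop] fun t => kap * (mkDat h).Gam F α t := by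
    filter_upwards [eventually_ge_atTop T] with t ht
    exact gamma_conv hg h hF hα (hT1.trans ht) (hT t ht)
  rw [tendsto_congr' he]
  constructor
  · intro H
    have := H.const_mul kap⁻¹
    simpa [kap_pos.ne'] using this
  · intro H
    simpa using H.const_mul kap

lemma hn_conv {g : R3 → ℝ} {β : ℝ → ℝ} (hg : GoodG g β) (h : SolSetting N φ) {F : ℝ → ℝ}
    (hF : IsSmoothChar F) {α : ℝ} (hα : 0 < α) (h2 : ∃ β₀, 3 / 2 ≤ β₀ ∧ H2 g N φ α β₀) :
    (mkDat h).HN F α := by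
  obtain ⟨β₀, hβ, h2⟩ := h2
  obtain ⟨C, hC, hb⟩ := h2 F hF
  obtain ⟨T, hT1, hT⟩ := ev_four hα
  refine ⟨T, hT1, C, fun t ht r hr => ?_⟩
  have ht1 : 1 ≤ t := hT1.trans ht
  have h3 := hb t ht1 (r • e0)
  have hn : ‖r • e0‖ = r := by simp [norm_smul, norm_e0, abs_of_pos hr]
  rw [F_g hg hF (by linarith) (hT t ht), hn] at h3
  refine le_trans h3 (mul_le_mul_of_nonneg_left ?_ hC.le)
  exact Real.rpow_le_rpow_of_exponent_le ht1 (by linarith)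

lemma moment_bd (h : SolSetting N φ) {t : ℝ} (ht : 1 ≤ t) :
    (∫ x : R3, ‖x‖ * ‖φ t x‖ ^ 2) ≤ kap * ((mkDat h).W1 t + kap⁻¹ * h.H1.choose) := by
  have ht0 : 0 < t := by linarith
  have e1 : ∫ x : R3, ‖x‖ * ‖φ t x‖ ^ 2 =
      kap * ∫ r in Set.Ioi (0 : ℝ), r * (r ^ 2 * ‖UU φ (t, r)‖ ^ 2) := by
    simp only [radial_UU h]
    rw [rad_integral (fun r => r * ‖UU φ (t, r)‖ ^ 2), smul_eq_mul]
    congr 1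
    refine integral_congr_ae (Eventually.of_forall fun r => ?_)
    simp only [smul_eq_mul]; ring
  rw [e1]
  refine mul_le_mul_of_nonneg_left ?_ kap_pos.le
  have iw := i_w h ht0
  have iu := i_u h ht0
  have hb := h1_bd h ht0
  set A := ∫ r in Set.Ioi (0 : ℝ), r ^ 2 * ‖UU φ (t, r)‖ ^ 2 with hA
  set B := ∫ r in Set.Ioi (0 : ℝ), r ^ 2 * ‖dX (UU φ) (t, r)‖ ^ 2
  have hB0 : 0 ≤ B := setIntegral_nonneg measurableSet_Ioi fun r _ => by positivity
  have hle : A + B ≤ kap⁻¹ * h.H1.choose := by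
    rw [inv_mul_eq_div, le_div_iff₀ kap_pos]; linarith
  have hW : (mkDat h).W1 t = ∫ r in Set.Ioi (1 / 2 : ℝ), r * (r ^ 2 * ‖UU φ (t, r)‖ ^ 2) := by
    unfold Dat.W1 Dat.rho mkDat
    simp only [rho_id]
  have hu : Set.Ioi (0 : ℝ) = Set.Ioc 0 (1 / 2) ∪ Set.Ioi (1 / 2) :=
    (Set.Ioc_union_Ioi_eq_Ioi (by norm_num)).symm
  have s1 : Set.Ioc (0 : ℝ) (1 / 2) ⊆ Set.Ioi 0 := Set.Ioc_subset_Ioi_self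
  have s2 : Set.Ioi (1 / 2 : ℝ) ⊆ Set.Ioi 0 := Set.Ioi_subset_Ioi (by norm_num)
  have e2 : ∫ r in Set.Ioi (0 : ℝ), r * (r ^ 2 * ‖UU φ (t, r)‖ ^ 2) =
      (∫ r in Set.Ioc (0 : ℝ) (1 / 2), r * (r ^ 2 * ‖UU φ (t, r)‖ ^ 2)) + (mkDat h).W1 t := by
    rw [hW, ← setIntegral_union (Set.Ioc_disjoint_Ioi le_rfl) measurableSet_Ioi (iw.mono_set s1)
      (iw.mono_set s2), ← hu]
  have e3 : ∫ r in Set.Ioc (0 : ℝ) (1 / 2), r * (r ^ 2 * ‖UU φ (t, r)‖ ^ 2) ≤ A := by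
    refine le_trans (setIntegral_mono_on (iw.mono_set s1) (iu.mono_set s1) measurableSet_Ioc
      fun r hr => ?_) (setIntegral_mono_set iu (Eventually.of_forall fun r => by positivity)
        s1.eventuallyLE)
    exact mul_le_of_le_one_left (by positivity) (by linarith [hr.2])
  rw [e2]; linarith

end

/-- Well-definedness of weakly localized states and `t^{1/2}` localization. -/
theorem weakly_localized_well_defined
    (g : R3 → ℝ) (β : ℝ → ℝ) (N : ℝ → ℝ → ℝ → ℝ) (φ : ℝ → R3 → ℂ)
    (hg : GoodG g β) (hφ : SolSetting N φ)
    (hH2 : ∀ α ∈ Set.Ioo (1 / 3 : ℝ) 1, ∃ β₀, 3 / 2 ≤ β₀ ∧ H2 g N φ α β₀)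
    (hex : ∃ α ∈ Set.Ioo (1 / 3 : ℝ) 1, ∃ F : ℝ → ℝ, IsSmoothChar F ∧
      Tendsto (fun t => GammaF g φ F α t) atTop (𝓝 0)) :
    (∀ α' ∈ Set.Ioo (1 / 3 : ℝ) 1, ∀ F' : ℝ → ℝ, IsSmoothChar F' →
        Tendsto (fun t => GammaF g φ F' α' t) atTop (𝓝 0)) ∧
      ∃ C > (0 : ℝ), ∀ t : ℝ, 1 ≤ t →
        (∫ x : R3, ‖x‖ * ‖φ t x‖ ^ 2) ≤ C * t ^ (1 / 2 : ℝ) := by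
  obtain ⟨α, hα, F, hF, hlim⟩ := hex
  have pos : ∀ a ∈ Set.Ioo (1 / 3 : ℝ) 1, 0 < a := fun a ha => by linarith [ha.1]
  have hN : ∀ a ∈ Set.Ioo (1 / 3 : ℝ) 1, ∀ G, IsSmoothChar G → (mkDat hφ).HN G a :=
    fun a ha G hG => hn_conv hg hφ hG (pos a ha) (hH2 a ha)
  have h0 := (lim_iff hg hφ hF (pos α hα)).1 hlim
  refine ⟨fun α' hα' F' hF' => (lim_iff hg hφ hF' (pos α' hα')).2
    ((mkDat hφ).concl1 hN hF hα h0 hF' hα'), ?_⟩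
  have hh : (1 / 2 : ℝ) ∈ Set.Ioo (1 / 3 : ℝ) 1 := by constructor <;> norm_num
  obtain ⟨C, hC, hW⟩ := (mkDat hφ).concl2 hF (hN _ hh F hF) ((mkDat hφ).concl1 hN hF hα h0 hF hh)
  have hk := kap_pos
  set M := kap⁻¹ * hφ.H1.choose with hM
  refine ⟨kap * (C + |M|) + 1, by positivity, fun t ht => ?_⟩
  refine (moment_bd hφ ht).trans ?_
  have h4 : 1 ≤ t ^ (1 / 2 : ℝ) := Real.one_le_rpow ht (by norm_num)
  have h5 := hW t ht
  have h6 : M ≤ |M| * t ^ (1 / 2 : ℝ) :=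
    (le_abs_self M).trans (le_mul_of_one_le_right (abs_nonneg _) h4)
  have h7 := mul_le_mul_of_nonneg_left (add_le_add h5 h6) hk.le
  have h8 : (kap * (C + |M|) + 1) * t ^ (1 / 2 : ℝ) =
    kap * (C * t ^ (1 / 2 : ℝ) + |M| * t ^ (1 / 2 : ℝ)) + t ^ (1 / 2 : ℝ) := by ring
  rw [h8]
  linarith
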